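/- arXiv:2211.05954 — 3 statements merged into one kernel-verified Lean document; each statement's English description precedes it below -/
import Mathlib

section
/- Consider the Gaussian sequence model with noise level σₙ and the SNR-aware parameter space Θ(kₙ, τₙ). Suppose εₙ = kₙ/n → 0 and μₙ = τₙ/σₙ → 0 as n → ∞. Then the minimax risk satisfies R(Θ(kₙ,τₙ), σₙ) = n σₙ² (εₙ μₙ² − εₙ² μₙ⁴ (1+o(1))). Moreover, the linear estimator η̂_L(y, λₙ) with tuning λₙ = (εₙ μₙ²)⁻¹ attains this risk up to second order: sup over θ ∈ Θ(kₙ,τₙ) of E_θ‖η̂_L(y,λₙ) − θ‖₂² = n σₙ² (εₙ μₙ² − εₙ² μₙ⁴ (1+o(1))). -/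
open MeasureTheory ProbabilityTheory Filter
open scoped ENNReal NNReal Topology

noncomputable section

/-- Gaussian sequence model: the law of `y` under parameter `θ`, the product of
the Gaussians `N(θ i, σ²)`. -/
def gsm (n : ℕ) (θ : Fin n → ℝ) (σ : ℝ) : Measure (Fin n → ℝ) :=
  MeasureTheory.Measure.pi fun i => gaussianReal (θ i) ((σ ^ 2).toNNReal)

/-- Squared-error risk `E_θ ‖est(y) − θ‖₂²` of an estimator at parameter `θ`. -/
def risk (n : ℕ) (σ : ℝ) (est : (Fin n → ℝ) → Fin n → ℝ) (θ : Fin n → ℝ) : ℝ≥0∞ :=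
  ∫⁻ y, ENNReal.ofReal (∑ i, (est y i - θ i) ^ 2) ∂(gsm n θ σ)

/-- The SNR-aware parameter space `Θ(k,τ) = {θ : ‖θ‖₀ ≤ k, ‖θ‖₂² ≤ k τ²}`. -/
def paramSet (n k : ℕ) (τ : ℝ) : Set (Fin n → ℝ) :=
  {θ | {i | θ i ≠ 0}.ncard ≤ k ∧ ∑ i, (θ i) ^ 2 ≤ (k : ℝ) * τ ^ 2}

/-- Minimax risk: infimum over measurable estimators of the supremum risk over `Θ`. -/
def minimaxRisk (n : ℕ) (σ : ℝ) (Θ : Set (Fin n → ℝ)) : ℝ≥0∞ :=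
  ⨅ (est : (Fin n → ℝ) → Fin n → ℝ) (_ : Measurable est), ⨆ θ ∈ Θ, risk n σ est θ

/-- Linear (ridge) estimator `[η̂_L(y,λ)]ᵢ = yᵢ/(1+λ)`. -/
def linEst (n : ℕ) (lam : ℝ) : (Fin n → ℝ) → Fin n → ℝ := fun y i => y i / (1 + lam)

lemma gauss_tilt (σ : ℝ) (hσ : 0 < σ) (t : ℝ) :
    gaussianReal t ((σ ^ 2).toNNReal) = (gaussianReal 0 ((σ ^ 2).toNNReal)).withDensity
      (fun x => ENNReal.ofReal (Real.exp (t / σ ^ 2 * x - t ^ 2 / (2 * σ ^ 2)))) := by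
  have hv : (σ ^ 2).toNNReal ≠ 0 := by
    simp [Real.toNNReal_eq_zero]; positivity
  have hv' : (((σ ^ 2).toNNReal : ℝ≥0) : ℝ) = σ ^ 2 := Real.coe_toNNReal _ (by positivity)
  rw [gaussianReal_of_var_ne_zero _ hv, gaussianReal_of_var_ne_zero _ hv,
    ← withDensity_mul _ (measurable_gaussianPDF _ _) (by fun_prop)]
  congr 1
  ext x
  simp only [Pi.mul_apply, gaussianPDF]
  rw [← ENNReal.ofReal_mul (gaussianPDFReal_nonneg _ _ _)]
  congr 1
  simp only [gaussianPDFReal, hv']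
  rw [mul_assoc _ (Real.exp _) (Real.exp _), ← Real.exp_add]
  congr 2
  field_simp
  ring

lemma pi_update_tilt (n : ℕ) (θ : Fin n → ℝ) (σ : ℝ) (hσ : 0 < σ) (i : Fin n) (hi : θ i = 0)
    (t : ℝ) :
    gsm n (Function.update θ i t) σ = (gsm n θ σ).withDensity
      (fun y => ENNReal.ofReal (Real.exp (t / σ ^ 2 * y i - t ^ 2 / (2 * σ ^ 2)))) := by
  set f : ℝ → ℝ≥0∞ := fun x => ENNReal.ofReal (Real.exp (t / σ ^ 2 * x - t ^ 2 / (2 * σ ^ 2)))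
    with hf
  have hfm : Measurable f := by rw [hf]; fun_prop
  unfold gsm
  apply Measure.pi_eq
  intro s hs
  rw [withDensity_apply _ (MeasurableSet.univ_pi hs)]
  rw [← lintegral_indicator (MeasurableSet.univ_pi hs)]
  set g : Fin n → ℝ → ℝ≥0∞ := fun j => (s j).indicator (if j = i then f else 1) with hg
  have hgm : ∀ j, Measurable (g j) := by
    intro j
    rw [hg]
    refine Measurable.indicator ?_ (hs j)
    split_ifs
    · exact hfm
    · exact measurable_one
  have h1 : ∀ y : Fin n → ℝ, (Set.univ.pi s).indicator (fun y => f (y i)) y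
      = ∏ j, g j (y j) := by
    intro y
    by_cases hy : y ∈ Set.univ.pi s
    · rw [Set.indicator_of_mem hy]
      have : ∀ j, g j (y j) = if j = i then f (y j) else 1 := by
        intro j
        simp only [hg]
        rw [Set.indicator_of_mem (hy j (Set.mem_univ j))]
        split_ifs <;> rfl
      simp [this]
    · rw [Set.indicator_of_notMem hy]
      simp only [Set.mem_univ_pi, not_forall] at hy
      obtain ⟨j, hj⟩ := hy
      symm
      apply Finset.prod_eq_zero (Finset.mem_univ j)
      simp only [hg]
      rw [Set.indicator_of_notMem hj]
  change ∫⁻ y, (Set.univ.pi s).indicator (fun y => f (y i)) y ∂_ = _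
  simp_rw [h1]
  have h2 := lintegral_prod_eq_prod_lintegral_of_indepFun
    (μ := Measure.pi fun i => gaussianReal (θ i) ((σ ^ 2).toNNReal))
    Finset.univ (fun (j : Fin n) (y : Fin n → ℝ) => g j (y j))
    (iIndepFun_pi fun j => (hgm j).aemeasurable) (fun j => (hgm j).comp (measurable_pi_apply j))
  refine h2.trans ?_
  refine Finset.prod_congr rfl fun j _ => ?_
  have := (measurePreserving_eval (fun i => gaussianReal (θ i) ((σ ^ 2).toNNReal)) j).lintegral_comp
    (hgm j)
  simp only [Function.eval] at this
  rw [this]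
  by_cases hj : j = i
  · subst hj
    simp only [hg, if_true, Function.update_self, hi]
    rw [lintegral_indicator (hs j), gauss_tilt σ hσ t, withDensity_apply _ (hs j)]
  · simp only [hg, if_neg hj, Function.update_of_ne hj]
    simp [lintegral_indicator_one (hs j)]

lemma point_ineq (m : ℕ) (τ w0 : ℝ) (hw0 : 0 < w0) (hm : 1 ≤ m) (d p r : Fin m → ℝ)
    (hpr : ∀ j, 2 * w0 ≤ p j + r j) :
    τ ^ 2 * ∑ j, (p j + r j) ≤
      ∑ j, (p j * ∑ l, (d l - if j = l then τ else 0) ^ 2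
        + r j * ∑ l, (d l - if j = l then -τ else 0) ^ 2)
      + τ ^ 2 / (2 * m * w0) * ∑ j, (p j - r j) ^ 2 := by
  have hm' : (0 : ℝ) < m := by exact_mod_cast hm
  have key : ∀ (u : ℝ) (j : Fin m), ∑ l, (d l - if j = l then u else 0) ^ 2
      = ∑ l, d l ^ 2 - 2 * u * d j + u ^ 2 := by
    intro u j
    have : ∀ l, (d l - if j = l then u else 0) ^ 2
      = d l ^ 2 - (if j = l then 2 * u * d l - u ^ 2 else 0) := by
      intro l; split_ifs <;> ring
    simp_rw [this, Finset.sum_sub_distrib, Finset.sum_ite_eq]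
    simp
    ring
  simp_rw [key]
  set A := ∑ l, d l ^ 2 with hA
  have hA0 : 0 ≤ A := Finset.sum_nonneg fun _ _ => sq_nonneg _
  have hW : 2 * m * w0 ≤ ∑ j, (p j + r j) := by
    calc 2 * m * w0 = ∑ j : Fin m, 2 * w0 := by simp; ring
      _ ≤ _ := Finset.sum_le_sum fun j _ => hpr j
  have e1 : ∑ j, (p j * (A - 2 * τ * d j + τ ^ 2) + r j * (A - 2 * -τ * d j + (-τ) ^ 2))
     = (A + τ ^ 2) * ∑ j, (p j + r j) - ∑ j, 2 * τ * (d j * (p j - r j)) := by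
    rw [Finset.mul_sum, ← Finset.sum_sub_distrib]
    exact Finset.sum_congr rfl fun j _ => by ring
  rw [e1]
  have e2 : 0 ≤ ∑ j, (d j * (2 * m * w0) - τ * (p j - r j)) ^ 2 / (2 * m * w0) :=
    Finset.sum_nonneg fun _ _ => by positivity
  have e3 : ∑ j, (d j * (2 * m * w0) - τ * (p j - r j)) ^ 2 / (2 * m * w0)
     = 2 * m * w0 * A - ∑ j, 2 * τ * (d j * (p j - r j)) 
       + τ ^ 2 / (2 * m * w0) * ∑ j, (p j - r j) ^ 2 := by
    rw [hA, Finset.mul_sum, Finset.mul_sum, ← Finset.sum_sub_distrib, ← Finset.sum_add_distrib]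
    refine Finset.sum_congr rfl fun j _ => ?_
    field_simp
    ring
  have := mul_le_mul_of_nonneg_left hW hA0
  linarith

instance gsm_prob (n : ℕ) (θ : Fin n → ℝ) (σ : ℝ) : IsProbabilityMeasure (gsm n θ σ) := by
  unfold gsm; infer_instance

lemma lint_exp (n : ℕ) (θ : Fin n → ℝ) (σ : ℝ) (i : Fin n) (hi : θ i = 0) (t h : ℝ)
    (hth : t ^ 2 * σ ^ 2 = 2 * h) :
    ∫⁻ y, ENNReal.ofReal ((Real.exp (t * y i - h) - Real.exp (-t * y i - h)) ^ 2) ∂(gsm n θ σ)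
      = ENNReal.ofReal (2 * (Real.exp (2 * h) - Real.exp (-2 * h))) := by
  have hv' : (((σ ^ 2).toNNReal : ℝ≥0) : ℝ) = σ ^ 2 := Real.coe_toNNReal _ (by positivity)
  have := (measurePreserving_eval (fun i => gaussianReal (θ i) ((σ ^ 2).toNNReal)) i).lintegral_comp
    (f := fun x => ENNReal.ofReal ((Real.exp (t * x - h) - Real.exp (-t * x - h)) ^ 2))
    (by fun_prop)
  simp only [Function.eval] at this
  unfold gsm
  rw [this, hi]
  have e : ∀ x, (Real.exp (t * x - h) - Real.exp (-t * x - h)) ^ 2 =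
     Real.exp (-2 * h) * Real.exp ((2 * t) * x) + Real.exp (-2 * h) * Real.exp ((-2 * t) * x) 
      - 2 * Real.exp (-2 * h) := by
    intro x
    have a1 : Real.exp (-2 * h) * Real.exp ((2 * t) * x) = Real.exp (t * x - h) ^ 2 := by
      rw [← Real.exp_add, ← Real.exp_nat_mul]; congr 1; push_cast; ring
    have a2 : Real.exp (-2 * h) * Real.exp ((-2 * t) * x) = Real.exp (-t * x - h) ^ 2 := by
      rw [← Real.exp_add, ← Real.exp_nat_mul]; congr 1; push_cast; ring
    have a3 : Real.exp (-2 * h) = Real.exp (t * x - h) * Real.exp (-t * x - h) := by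
      rw [← Real.exp_add]; congr 1; ring
    rw [a1, a2, a3]; ring
  have i1 : ∀ s : ℝ, Integrable (fun x => Real.exp (-2 * h) * Real.exp (s * x))
    (gaussianReal 0 ((σ ^ 2).toNNReal)) := fun s => (integrable_exp_mul_gaussianReal s).const_mul _
  have i2 : ∀ s : ℝ, ∫ x, Real.exp (s * x) ∂(gaussianReal 0 ((σ ^ 2).toNNReal))
    = Real.exp (σ ^ 2 * s ^ 2 / 2) := by
    intro s
    have := congrFun (mgf_fun_id_gaussianReal (μ := 0) (v := (σ ^ 2).toNNReal)) s
    simpa [mgf, hv'] using this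
  rw [← ofReal_integral_eq_lintegral_ofReal]
  · congr 1
    simp_rw [e]
    rw [integral_sub (f := fun x => Real.exp (-2 * h) * Real.exp ((2 * t) * x)
        + Real.exp (-2 * h) * Real.exp ((-2 * t) * x)) ((i1 _).add (i1 _)) (integrable_const _),
      integral_add (i1 _) (i1 _),
      integral_const_mul, integral_const_mul, i2, i2]
    simp only [integral_const, probReal_univ, one_smul]
    rw [← Real.exp_add, ← Real.exp_add]
    rw [show -2 * h + σ ^ 2 * (2 * t) ^ 2 / 2 = 2 * h by linarith,
     show -2 * h + σ ^ 2 * (-2 * t) ^ 2 / 2 = 2 * h by linarith]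
    ring
  · simp_rw [e]
    exact ((i1 _).add (i1 _)).sub (integrable_const _)
  · exact ae_of_all _ fun x => sq_nonneg _

def sg (τ : ℝ) (v : Bool) : ℝ := if v then τ else -τ

lemma sg_sq (τ : ℝ) (v : Bool) : sg τ v ^ 2 = τ ^ 2 := by cases v <;> simp [sg]

/-- One block. -/
lemma block (n m : ℕ) (hm : 1 ≤ m) (σ τ : ℝ) (hσ : 0 < σ) (θ : Fin n → ℝ) (e : Fin m → Fin n)
    (he : Function.Injective e) (h0 : ∀ j, θ (e j) = 0)
    (est : (Fin n → ℝ) → Fin n → ℝ) (hest : Measurable est) :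
    ENNReal.ofReal (2 * m * τ ^ 2) ≤ 
    ∑ c : Fin m × Bool, ∫⁻ y, ENNReal.ofReal
      (∑ l, (est y (e l) - Function.update θ (e c.1) (sg τ c.2) (e l)) ^ 2)
        ∂(gsm n (Function.update θ (e c.1) (sg τ c.2)) σ)
    + ENNReal.ofReal (τ ^ 2 * (Real.exp (3 * (τ ^ 2 / (2 * σ ^ 2)))
        - Real.exp (- (τ ^ 2 / (2 * σ ^ 2))))) := by
  have hm' : (0 : ℝ) < m := by exact_mod_cast hm
  set h := τ ^ 2 / (2 * σ ^ 2) with hh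
  set W : Fin m × Bool → (Fin n → ℝ) → ℝ :=
    fun c y => Real.exp (sg τ c.2 / σ ^ 2 * y (e c.1) - h) with hW
  have hWm : ∀ c, Measurable (W c) := fun c => by rw [hW]; fun_prop
  set G : Fin m × Bool → (Fin n → ℝ) → ℝ := fun c y =>
    ∑ l, (est y (e l) - if c.1 = l then sg τ c.2 else 0) ^ 2 with hG
  have hestl : ∀ l, Measurable fun y => est y (e l) := fun l =>
    (measurable_pi_apply (e l)).comp hest
  have hGm : ∀ c, Measurable (G c) := fun c => by
    rw [hG]
    refine Finset.measurable_sum _ fun l _ => ?_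
    exact ((hestl l).sub_const _).pow_const 2
  have hG0 : ∀ c y, 0 ≤ G c y := fun c y => Finset.sum_nonneg fun _ _ => sq_nonneg _
  have htilt : ∀ c : Fin m × Bool, gsm n (Function.update θ (e c.1) (sg τ c.2)) σ
      = (gsm n θ σ).withDensity (fun y => ENNReal.ofReal (W c y)) := by
    intro c
    rw [pi_update_tilt n θ σ hσ _ (h0 _), sg_sq]
  have hint : ∀ c : Fin m × Bool, ∫⁻ y, ENNReal.ofReal
      (∑ l, (est y (e l) - Function.update θ (e c.1) (sg τ c.2) (e l)) ^ 2)
        ∂(gsm n (Function.update θ (e c.1) (sg τ c.2)) σ)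
      = ∫⁻ y, ENNReal.ofReal (W c y * G c y) ∂(gsm n θ σ) := by
    intro c
    have : ∀ y, (∑ l, (est y (e l) - Function.update θ (e c.1) (sg τ c.2) (e l)) ^ 2) = G c y := by
      intro y
      refine Finset.sum_congr rfl fun l _ => ?_
      by_cases hl : c.1 = l
      · subst hl; simp
      · rw [if_neg hl, Function.update_of_ne (fun hc => hl (he hc).symm), h0]
    simp_rw [this]
    rw [htilt, lintegral_withDensity_eq_lintegral_mul _ (hWm c).ennreal_ofReal
      (hGm c).ennreal_ofReal]
    refine lintegral_congr fun y => ?_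
    rw [Pi.mul_apply, ENNReal.ofReal_mul (Real.exp_nonneg _)]
  have hWint : ∀ c, ∫⁻ y, ENNReal.ofReal (W c y) ∂(gsm n θ σ) = 1 := by
    intro c
    have : gsm n (Function.update θ (e c.1) (sg τ c.2)) σ Set.univ = 1 := measure_univ
    rw [htilt, withDensity_apply _ MeasurableSet.univ] at this
    simpa using this
  set V : Fin m → (Fin n → ℝ) → ℝ := fun j y =>
    (Real.exp (τ / σ ^ 2 * y (e j) - h) - Real.exp (- (τ / σ ^ 2) * y (e j) - h)) ^ 2 with hV
  have hVm : ∀ j, Measurable (V j) := fun j => by rw [hV]; fun_prop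
  have hVint : ∀ j, ∫⁻ y, ENNReal.ofReal (V j y) ∂(gsm n θ σ)
      = ENNReal.ofReal (2 * (Real.exp (2 * h) - Real.exp (-2 * h))) := fun j =>
    lint_exp n θ σ (e j) (h0 j) (τ / σ ^ 2) h (by rw [hh]; field_simp)
  set C := τ ^ 2 / (2 * m * Real.exp (-h)) with hC
  have hC0 : 0 ≤ C := by positivity
  have pt : ∀ y, ∑ c, ENNReal.ofReal (τ ^ 2) * ENNReal.ofReal (W c y) ≤
      ∑ c, ENNReal.ofReal (W c y * G c y) + ∑ j, ENNReal.ofReal C * ENNReal.ofReal (V j y) := by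
    intro y
    have := point_ineq m τ (Real.exp (-h)) (Real.exp_pos _) hm (fun l => est y (e l))
      (fun j => W (j, true) y) (fun j => W (j, false) y) (by
        intro j
        simp only [hW, sg]
        have a1 := Real.add_one_le_exp (τ / σ ^ 2 * y (e j))
        have a2 := Real.add_one_le_exp (-τ / σ ^ 2 * y (e j))
        simp only [if_true, Bool.false_eq_true, if_false, sub_eq_add_neg, Real.exp_add]
        rw [← add_mul]
        refine mul_le_mul_of_nonneg_right ?_ (Real.exp_nonneg _)
        have : -τ / σ ^ 2 * y (e j) = - (τ / σ ^ 2 * y (e j)) := by ring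
        rw [this] at a2 ⊢
        linarith)
    simp_rw [← ENNReal.ofReal_mul (sq_nonneg τ), ← ENNReal.ofReal_mul hC0]
    rw [← ENNReal.ofReal_sum_of_nonneg (fun c _ => mul_nonneg (sq_nonneg _) (Real.exp_nonneg _)),
      ← ENNReal.ofReal_sum_of_nonneg (fun c _ => mul_nonneg (Real.exp_nonneg _) (hG0 _ _)),
      ← ENNReal.ofReal_sum_of_nonneg (fun c _ => mul_nonneg hC0 (sq_nonneg _)),
      ← ENNReal.ofReal_add (Finset.sum_nonneg fun c _ => mul_nonneg (Real.exp_nonneg _) (hG0 _ _))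
       (Finset.sum_nonneg fun c _ => mul_nonneg hC0 (sq_nonneg _))]
    apply ENNReal.ofReal_le_ofReal
    rw [← Finset.mul_sum, ← Finset.mul_sum, Fintype.sum_prod_type, Fintype.sum_prod_type]
    simp only [Fintype.sum_bool]
    have hVW : ∀ j, V j y = (W (j, true) y - W (j, false) y) ^ 2 := by
      intro j
      simp only [hV, hW, sg]
      simp [neg_div]
    simp_rw [← hVW] at this
    exact this
  have hWG : ∀ c, Measurable fun y => ENNReal.ofReal (W c y * G c y) := fun c =>
    ((hWm c).mul (hGm c)).ennreal_ofReal
  have hle := lintegral_mono (μ := gsm n θ σ) pt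
  rw [lintegral_finsetSum _ (fun c _ => (hWm c).ennreal_ofReal.const_mul _),
    lintegral_add_left (Finset.measurable_sum _ fun c _ => hWG c),
    lintegral_finsetSum _ (fun c _ => hWG c),
    lintegral_finsetSum _ (fun c _ => (hVm c).ennreal_ofReal.const_mul _)] at hle
  simp_rw [hint]
  refine le_trans (le_of_eq ?_) (hle.trans (add_le_add_right (le_of_eq ?_) _))
  · simp_rw [lintegral_const_mul _ (hWm _).ennreal_ofReal, hWint]
    simp only [mul_one, Finset.sum_const, Finset.card_univ, Fintype.card_prod, Fintype.card_fin,
      Fintype.card_bool, nsmul_eq_mul]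
    rw [← ENNReal.ofReal_natCast, ← ENNReal.ofReal_mul (by positivity)]
    congr 1; push_cast; ring
  · simp_rw [lintegral_const_mul _ (hVm _).ennreal_ofReal, hVint]
    simp only [Finset.sum_const, Finset.card_univ, Fintype.card_fin, nsmul_eq_mul]
    rw [← ENNReal.ofReal_natCast, ← ENNReal.ofReal_mul hC0, ← ENNReal.ofReal_mul (by positivity)]
    congr 1
    rw [hC]
    have b1 : Real.exp (2 * h) = Real.exp (3 * h) * Real.exp (-h) := by
      rw [← Real.exp_add]; congr 1; ring
    have b2 : Real.exp (-2 * h) = Real.exp (-h) * Real.exp (-h) := by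
      rw [← Real.exp_add]; congr 1; ring
    rw [b1, b2]
    have := Real.exp_pos (-h)
    field_simp

lemma sum_update {κ α : Type*} [Fintype κ] [DecidableEq κ] [Fintype α] (F : (κ → α) → ℝ≥0∞)
    (b : κ) : ∑ s : κ → α, ∑ c : α, F (Function.update s b c)
      = (Fintype.card α : ℝ≥0∞) * ∑ s, F s := by
  rw [← Fintype.sum_prod_type' (fun (s : κ → α) (c : α) => F (Function.update s b c))]
  have : (Fintype.card α : ℝ≥0∞) * ∑ s, F s = ∑ x : (κ → α) × α, F x.1 := by
    rw [Fintype.sum_prod_type]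
    simp [Finset.mul_sum]
  rw [this]
  refine Finset.sum_nbij' (fun x => (Function.update x.1 b x.2, x.1 b))
    (fun x => (Function.update x.1 b x.2, x.1 b)) ?_ ?_ ?_ ?_ ?_ <;> simp

/-- configuration -/
def cfg {k m n : ℕ} (e : Fin k × Fin m → Fin n) (τ : ℝ) (s : Fin k → Fin m × Bool) : Fin n → ℝ :=
  Function.extend e (fun x => if (s x.1).1 = x.2 then sg τ (s x.1).2 else 0) 0

/-- configuration with a block removed -/
def cfg0 {k m n : ℕ} (e : Fin k × Fin m → Fin n) (τ : ℝ) (b : Fin k) (s : Fin k → Fin m × Bool) :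
    Fin n → ℝ :=
  Function.extend e
    (fun x => if x.1 = b then 0 else if (s x.1).1 = x.2 then sg τ (s x.1).2 else 0) 0

lemma cfg_update {k m n : ℕ} (e : Fin k × Fin m → Fin n) (he : Function.Injective e) (τ : ℝ)
    (b : Fin k) (s : Fin k → Fin m × Bool) (c : Fin m × Bool) :
    cfg e τ (Function.update s b c) =
      Function.update (cfg0 e τ b s) (e (b, c.1)) (sg τ c.2) := by
  ext p
  by_cases hp : ∃ x, e x = p
  · obtain ⟨⟨b', j⟩, rfl⟩ := hp
    rw [cfg, he.extend_apply]
    by_cases hb : b' = b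
    · subst hb
      by_cases hj : c.1 = j
      · subst hj; simp
      · have hne : e (b', j) ≠ e (b', c.1) := fun h => hj (by
          have := he h; simp at this; exact this.symm)
        rw [Function.update_of_ne (a := e (b', j)) hne, cfg0, he.extend_apply]
        simp [hj]
    · have hne : e (b', j) ≠ e (b, c.1) := fun h => hb (by
        have := he h; simp at this; exact this.1)
      rw [Function.update_of_ne (a := e (b', j)) hne, cfg0, he.extend_apply]
      simp [hb]
  · rw [cfg, Function.extend_apply' _ _ _ hp, Function.update_of_ne (fun h => hp ⟨_, h.symm⟩),
      cfg0, Function.extend_apply' _ _ _ hp]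

lemma cfg_mem {k m n : ℕ} (e : Fin k × Fin m → Fin n) (he : Function.Injective e) (τ : ℝ)
    (s : Fin k → Fin m × Bool) : cfg e τ s ∈ paramSet n k τ := by
  constructor
  · have : {i | cfg e τ s i ≠ 0} ⊆ Set.range (fun b => e (b, (s b).1)) := by
      intro p hp
      by_cases hp' : ∃ x, e x = p
      · obtain ⟨⟨b', j⟩, rfl⟩ := hp'
        simp only [Set.mem_ofPred_eq, cfg, he.extend_apply] at hp
        refine ⟨b', ?_⟩
        by_contra hne
        apply hp
        rw [if_neg]
        intro h; apply hne; simp [h]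
      · exact absurd (by rw [cfg, Function.extend_apply' _ _ _ hp']; rfl) hp
    refine (Set.ncard_le_ncard this (Set.toFinite _)).trans ?_
    rw [← Set.image_univ]
    refine (Set.ncard_image_le (Set.toFinite _)).trans ?_
    simp [Set.ncard_univ]
  · apply le_of_eq
    rw [← Fintype.sum_of_injective e he (fun x => (if (s x.1).1 = x.2 then τ ^ 2 else 0))
      (fun p => cfg e τ s p ^ 2)]
    · rw [Fintype.sum_prod_type]; simp
    · intro p hp
      rw [cfg, Function.extend_apply' _ _ _ (by simpa using hp)]; simp
    · intro x
      rw [cfg, he.extend_apply]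
      split_ifs
      · rw [sg_sq]
      · simp

lemma lower_est (n k m : ℕ) (hm : 1 ≤ m) (hkm : k * m ≤ n) (σ τ : ℝ) (hσ : 0 < σ)
    (est : (Fin n → ℝ) → Fin n → ℝ) (hest : Measurable est) (M : ℝ≥0∞)
    (hM : ∀ θ ∈ paramSet n k τ, risk n σ est θ ≤ M) :
    ENNReal.ofReal (k * (2 * m * τ ^ 2)) ≤ ENNReal.ofReal (2 * m) * M + 
     ENNReal.ofReal (k * (τ ^ 2 * (Real.exp (3 * (τ ^ 2 / (2 * σ ^ 2)))
        - Real.exp (- (τ ^ 2 / (2 * σ ^ 2)))))) := by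
  set D := (τ ^ 2 * (Real.exp (3 * (τ ^ 2 / (2 * σ ^ 2)))
        - Real.exp (- (τ ^ 2 / (2 * σ ^ 2))))) with hD
  set e : Fin k × Fin m → Fin n := fun x => Fin.castLE hkm (finProdFinEquiv x) with hedef
  have he : Function.Injective e := fun x y h => by
    simpa [hedef] using h
  set F : Fin k → (Fin k → Fin m × Bool) → ℝ≥0∞ := fun b s =>
    ∫⁻ y, ENNReal.ofReal (∑ l, (est y (e (b, l)) - cfg e τ s (e (b, l))) ^ 2)
      ∂(gsm n (cfg e τ s) σ) with hF
  have hestl : ∀ l, Measurable fun y => est y l := fun l =>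
    (measurable_pi_apply l).comp hest
  have h1 : ∀ s, ∑ b, F b s ≤ M := by
    intro s
    refine le_trans ?_ (hM _ (cfg_mem e he τ s))
    rw [risk, hF, ← lintegral_finsetSum]
    · refine lintegral_mono fun y => ?_
      rw [← ENNReal.ofReal_sum_of_nonneg (fun b _ => Finset.sum_nonneg fun _ _ => sq_nonneg _)]
      apply ENNReal.ofReal_le_ofReal
      rw [← Fintype.sum_prod_type' (fun b l => (est y (e (b, l)) - cfg e τ s (e (b, l))) ^ 2)]
      rw [← Finset.sum_image (s := Finset.univ) (g := e)
        (f := fun p => (est y p - cfg e τ s p) ^ 2) (he.injOn)]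
      exact Finset.sum_le_sum_of_subset_of_nonneg (Finset.subset_univ _)
        (fun _ _ _ => sq_nonneg _)
    · intro b _
      refine Measurable.ennreal_ofReal ?_
      refine Finset.measurable_sum _ fun l _ => ?_
      exact ((hestl _).sub_const _).pow_const 2
  have h2 : ∀ b s, ENNReal.ofReal (2 * m * τ ^ 2) ≤
      ∑ c, F b (Function.update s b c) + ENNReal.ofReal D := by
    intro b s
    have := block n m hm σ τ hσ (cfg0 e τ b s) (fun j => e (b, j))
      (fun x y h => by have := he h; simpa using this)
      (fun j => by rw [cfg0, he.extend_apply]; simp) est hest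
    simp only [hF, cfg_update e he]
    exact this
  set N : ℝ≥0∞ := (Fintype.card (Fin k → Fin m × Bool) : ℝ≥0∞) with hN
  have hN0 : N ≠ 0 := by
    have : Nonempty (Fin m) := ⟨⟨0, hm⟩⟩
    rw [hN]; exact_mod_cast Fintype.card_ne_zero
  have hNt : N ≠ ⊤ := ENNReal.natCast_ne_top _
  have hD0 : 0 ≤ D := by
    apply mul_nonneg (sq_nonneg _)
    rw [sub_nonneg]
    apply Real.exp_le_exp.mpr
    have : 0 ≤ τ ^ 2 / (2 * σ ^ 2) := by positivity
    linarith
  have h3 : ∀ b, N * ENNReal.ofReal (2 * m * τ ^ 2) ≤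
      ENNReal.ofReal (2 * m) * ∑ s, F b s + N * ENNReal.ofReal D := by
    intro b
    have h4 := Finset.sum_le_sum (s := Finset.univ) fun s (_ : s ∈ Finset.univ) => h2 b s
    rw [Finset.sum_add_distrib, sum_update (F b) b] at h4
    simp only [Finset.sum_const, Finset.card_univ, nsmul_eq_mul] at h4
    have : ENNReal.ofReal (2 * m) = (Fintype.card (Fin m × Bool) : ℝ≥0∞) := by
      rw [← ENNReal.ofReal_natCast]; congr 1; simp; ring
    rw [this]
    exact h4
  have h5 := Finset.sum_le_sum (s := Finset.univ) fun b (_ : b ∈ Finset.univ) => h3 b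
  have h6 : ∑ b, ∑ s, F b s ≤ N * M := by
    rw [Finset.sum_comm]
    refine (Finset.sum_le_sum fun s _ => h1 s).trans ?_
    simp [hN]
  rw [Finset.sum_add_distrib, ← Finset.mul_sum (f := fun b => ∑ s, F b s)] at h5
  simp only [Finset.sum_const, Finset.card_univ, nsmul_eq_mul, Fintype.card_fin] at h5
  have h7 : N * ENNReal.ofReal (k * (2 * m * τ ^ 2)) ≤
      N * (ENNReal.ofReal (2 * m) * M + ENNReal.ofReal (k * D)) := by
    rw [ENNReal.ofReal_mul (by positivity), ENNReal.ofReal_mul (p := (k : ℝ)) (by positivity),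
      ENNReal.ofReal_natCast]
    calc N * (k * ENNReal.ofReal (2 * m * τ ^ 2)) = k * (N * ENNReal.ofReal (2 * m * τ ^ 2)) := by
          ring
      _ ≤ _ := h5
      _ ≤ ENNReal.ofReal (2 * m) * (N * M) + k * (N * ENNReal.ofReal D) := by gcongr
      _ = _ := by ring
  exact (ENNReal.mul_le_mul_iff_right hN0 hNt).mp h7

lemma lower_mm (n k m : ℕ) (hm : 1 ≤ m) (hkm : k * m ≤ n) (σ τ : ℝ) (hσ : 0 < σ) :
    ENNReal.ofReal (k * τ ^ 2 - k * τ ^ 2 / (2 * m) * (Real.exp (3 * (τ ^ 2 / (2 * σ ^ 2)))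
        - Real.exp (- (τ ^ 2 / (2 * σ ^ 2))))) ≤ minimaxRisk n σ (paramSet n k τ) := by
  have hm' : (0 : ℝ) < m := by exact_mod_cast hm
  refine le_iInf₂ fun est hest => ?_
  set M := ⨆ θ ∈ paramSet n k τ, risk n σ est θ
  by_cases hMt : M = ⊤
  · rw [hMt]; exact le_top
  have := lower_est n k m hm hkm σ τ hσ est hest M (fun θ hθ => le_iSup₂_of_le θ hθ le_rfl)
  have hx : 0 ≤ τ ^ 2 / (2 * σ ^ 2) := by positivity
  have hq : 0 ≤ Real.exp (3 * (τ ^ 2 / (2 * σ ^ 2))) - Real.exp (- (τ ^ 2 / (2 * σ ^ 2))) := by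
    rw [sub_nonneg]
    apply Real.exp_le_exp.mpr
    linarith
  set q := Real.exp (3 * (τ ^ 2 / (2 * σ ^ 2))) - Real.exp (- (τ ^ 2 / (2 * σ ^ 2)))
  rw [← ENNReal.ofReal_toReal hMt] at this ⊢
  rw [← ENNReal.ofReal_mul (by positivity), ← ENNReal.ofReal_add (by positivity) (by positivity),
    ENNReal.ofReal_le_ofReal_iff (by positivity)] at this
  apply ENNReal.ofReal_le_ofReal
  have h2 : (k * τ ^ 2 - k * τ ^ 2 / (2 * m) * q) * (2 * m) ≤ M.toReal * (2 * m) := by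
    have : (k * τ ^ 2 - k * τ ^ 2 / (2 * m) * q) * (2 * m)
      = k * (2 * m * τ ^ 2) - k * (τ ^ 2 * q) := by field_simp
    rw [this]; linarith
  exact le_of_mul_le_mul_right h2 (by positivity)

lemma risk_lin (n : ℕ) (σ lam : ℝ) (θ : Fin n → ℝ) :
    risk n σ (linEst n lam) θ = ENNReal.ofReal
      ((1 / (1 + lam)) ^ 2 * (n * σ ^ 2) + (1 - 1 / (1 + lam)) ^ 2 * ∑ i, θ i ^ 2) := by
  set a := 1 / (1 + lam) with ha
  have hv' : (((σ ^ 2).toNNReal : ℝ≥0) : ℝ) = σ ^ 2 := Real.coe_toNNReal _ (by positivity)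
  have h1 : ∀ i, ∫⁻ y, ENNReal.ofReal ((linEst n lam y i - θ i) ^ 2) ∂(gsm n θ σ)
      = ENNReal.ofReal (a ^ 2 * σ ^ 2 + (1 - a) ^ 2 * θ i ^ 2) := by
    intro i
    have := (measurePreserving_eval (fun i => gaussianReal (θ i) ((σ ^ 2).toNNReal)) i).lintegral_comp
      (f := fun x => ENNReal.ofReal ((x / (1 + lam) - θ i) ^ 2)) (by fun_prop)
    simp only [Function.eval] at this
    unfold gsm linEst
    rw [this]
    set γ := gaussianReal (θ i) ((σ ^ 2).toNNReal)
    have hmem : MemLp (fun x : ℝ => x) 2 γ := memLp_id_gaussianReal 2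
    have hint : Integrable (fun x : ℝ => x) γ := hmem.integrable (by norm_num)
    have e : ∀ x, (x / (1 + lam) - θ i) ^ 2
        = a ^ 2 * (x - θ i) ^ 2 + (2 * a * (a - 1) * θ i * (x - θ i) + (1 - a) ^ 2 * θ i ^ 2) := by
      intro x; rw [ha]; ring
    have j1 : Integrable (fun x => a ^ 2 * (x - θ i) ^ 2) γ :=
      ((hmem.sub (memLp_const (θ i))).integrable_sq).const_mul _
    have j2 : Integrable (fun x => 2 * a * (a - 1) * θ i * (x - θ i)) γ :=
      (hint.sub (integrable_const _)).const_mul _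
    have v : ∫ x, (x - θ i) ^ 2 ∂γ = σ ^ 2 := by
      have := variance_fun_id_gaussianReal (μ := θ i) (v := (σ ^ 2).toNNReal)
      rw [variance_eq_integral (by fun_prop), hv', integral_id_gaussianReal] at this
      exact this
    have v1 : ∫ x, (x - θ i) ∂γ = 0 := by
      rw [integral_sub hint (integrable_const _), integral_id_gaussianReal]; simp [γ]
    have j2' : ∀ C : ℝ, Integrable (fun x => 2 * a * (a - 1) * θ i * (x - θ i) + C) γ :=
      fun C => j2.add (integrable_const _)
    rw [← ofReal_integral_eq_lintegral_ofReal]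
    · congr 1
      simp_rw [e]
      rw [integral_add j1 (j2' _), integral_add j2 (integrable_const _),
        integral_const_mul, integral_const_mul, v, v1]
      simp [γ]
    · simp_rw [e]
      exact j1.add (j2.add (integrable_const _))
    · exact ae_of_all _ fun x => sq_nonneg _
  rw [risk]
  simp_rw [ENNReal.ofReal_sum_of_nonneg (fun i _ => sq_nonneg _)]
  rw [lintegral_finsetSum]
  · simp_rw [h1]
    rw [← ENNReal.ofReal_sum_of_nonneg (fun i _ => by positivity)]
    congr 1
    rw [Finset.sum_add_distrib, ← Finset.mul_sum (f := fun i => θ i ^ 2)]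
    simp; ring
  · intro i _
    unfold linEst
    fun_prop

lemma sup_lin (n k : ℕ) (hkn : k ≤ n) (σ τ : ℝ) (lam : ℝ) :
    (⨆ θ ∈ paramSet n k τ, risk n σ (linEst n lam) θ) = ENNReal.ofReal
      ((1 / (1 + lam)) ^ 2 * (n * σ ^ 2) + (1 - 1 / (1 + lam)) ^ 2 * (k * τ ^ 2)) := by
  apply le_antisymm
  · refine iSup₂_le fun θ hθ => ?_
    rw [risk_lin]
    apply ENNReal.ofReal_le_ofReal
    have := hθ.2
    gcongr
  · set e : Fin k × Fin 1 → Fin n := fun x => Fin.castLE hkn x.1 with he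
    have hei : Function.Injective e := fun x y h => by
      have : x.1 = y.1 := by simpa [he] using h
      exact Prod.ext this (Subsingleton.elim _ _)
    set s : Fin k → Fin 1 × Bool := fun _ => (0, true)
    refine le_iSup₂_of_le (cfg e τ s) (cfg_mem e hei τ s) ?_
    rw [risk_lin]
    apply le_of_eq
    congr 3
    rw [← Fintype.sum_of_injective e hei (fun x => τ ^ 2)
      (fun p => cfg e τ s p ^ 2)]
    · simp
    · intro p hp
      rw [cfg, Function.extend_apply' _ _ _ (by simpa using hp)]; simp
    · intro x
      rw [cfg, hei.extend_apply, if_pos (Subsingleton.elim _ _), sg_sq]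

lemma lim_q (x : ℕ → ℝ) (hx : Tendsto x atTop (𝓝 0)) (hx0 : ∀ n, x n ≠ 0) :
    Tendsto (fun n => (Real.exp (3 * x n) - Real.exp (-x n)) / (4 * x n)) atTop (𝓝 1) := by
  have hd : HasDerivAt (fun u : ℝ => Real.exp (3 * u) - Real.exp (-u)) 4 0 := by
    have h1 : HasDerivAt (fun u : ℝ => Real.exp (3 * u)) (Real.exp (3 * 0) * (3 * 1)) 0 :=
      ((hasDerivAt_id (0 : ℝ)).const_mul 3).exp
    have h2 : HasDerivAt (fun u : ℝ => Real.exp (-u)) (Real.exp (-0) * (-1)) 0 :=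
      ((hasDerivAt_id (0 : ℝ)).neg).exp
    refine (h1.sub h2).congr_deriv ?_
    rw [mul_zero, neg_zero, Real.exp_zero]; norm_num
  have hs := hd.tendsto_slope_zero
  have hx' : Tendsto x atTop (𝓝[≠] 0) :=
    tendsto_nhdsWithin_iff.mpr ⟨hx, Eventually.of_forall hx0⟩
  have := (hs.comp hx').div_const 4
  rw [div_self (by norm_num)] at this
  refine this.congr fun n => ?_
  have := hx0 n
  simp only [Function.comp_apply, zero_add, mul_zero, neg_zero, sub_self, sub_zero, smul_eq_mul]
  field_simp

/-- Theorem `thm::regime_1`, Regime I. -/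
theorem statement0
    (k : ℕ → ℕ) (τ σ ε μ : ℕ → ℝ)
    (hk : ∀ n, 1 ≤ n → 1 ≤ k n ∧ k n ≤ n)
    (hτ : ∀ n, 0 < τ n) (hσ : ∀ n, 0 < σ n)
    (hε : ∀ n, ε n = (k n : ℝ) / n) (hμ : ∀ n, μ n = τ n / σ n)
    (hε0 : Tendsto ε atTop (𝓝 0)) (hμ0 : Tendsto μ atTop (𝓝 0)) :
    (∃ c : ℕ → ℝ, Tendsto c atTop (𝓝 1) ∧
      ∀ᶠ n in atTop,
        minimaxRisk n (σ n) (paramSet n (k n) (τ n)) =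
          ENNReal.ofReal ((n : ℝ) * σ n ^ 2 *
            (ε n * μ n ^ 2 - ε n ^ 2 * μ n ^ 4 * c n))) ∧
    (∃ c : ℕ → ℝ, Tendsto c atTop (𝓝 1) ∧
      ∀ᶠ n in atTop,
        (⨆ θ ∈ paramSet n (k n) (τ n),
            risk n (σ n) (linEst n ((ε n * μ n ^ 2)⁻¹)) θ) =
          ENNReal.ofReal ((n : ℝ) * σ n ^ 2 *
            (ε n * μ n ^ 2 - ε n ^ 2 * μ n ^ 4 * c n))) := by
  have hμpos : ∀ n, 0 < μ n := fun n => by rw [hμ]; exact div_pos (hτ n) (hσ n)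
  have hεpos : ∀ n : ℕ, 1 ≤ n → 0 < ε n := fun n hn => by
    rw [hε]
    have h1 : (0 : ℝ) < k n := by exact_mod_cast (hk n hn).1
    have h2 : (0 : ℝ) < n := by exact_mod_cast hn
    positivity
  set a : ℕ → ℝ := fun n => ε n * μ n ^ 2 with ha
  have hapos : ∀ n : ℕ, 1 ≤ n → 0 < a n := fun n hn => mul_pos (hεpos n hn) (pow_pos (hμpos n) 2)
  have ha0 : Tendsto a atTop (𝓝 0) := by
    have := hε0.mul (hμ0.pow 2)
    simpa using this
  have hrep : ∀ n, ε n ^ 2 * μ n ^ 4 = a n ^ 2 := fun n => by simp only [ha]; ring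
  have hkt : ∀ n : ℕ, 1 ≤ n → (k n : ℝ) * τ n ^ 2 = n * σ n ^ 2 * a n := by
    intro n hn
    have h2 : (0 : ℝ) < n := by exact_mod_cast hn
    have := hσ n
    simp only [ha, hε, hμ]
    field_simp
  have hlow1 : Tendsto (fun n => 1 / (1 + a n)) atTop (𝓝 1) := by
    have := (ha0.const_add 1).inv₀ (by norm_num)
    simpa using this
  have hlin : ∀ n : ℕ, 1 ≤ n → (⨆ θ ∈ paramSet n (k n) (τ n),
            risk n (σ n) (linEst n ((a n)⁻¹)) θ) =
          ENNReal.ofReal ((n : ℝ) * σ n ^ 2 * (a n - a n ^ 2 * (1 / (1 + a n)))) := by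
    intro n hn
    rw [sup_lin n (k n) (hk n hn).2, hkt n hn]
    congr 1
    have h1 := hapos n hn
    have h3 : 1 / (1 + (a n)⁻¹) = a n / (1 + a n) := by field_simp; ring
    rw [h3]
    field_simp
    ring
  simp_rw [hrep]
  refine ⟨?_, fun n => 1 / (1 + a n), hlow1, ?_⟩
  swap
  · filter_upwards [eventually_ge_atTop 1] with n hn using hlin n hn
  set R : ℕ → ℝ≥0∞ := fun n => minimaxRisk n (σ n) (paramSet n (k n) (τ n)) with hR
  set h : ℕ → ℝ := fun n => τ n ^ 2 / (2 * σ n ^ 2) with hh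
  have hhμ : ∀ n, h n = μ n ^ 2 / 2 := fun n => by
    simp only [hh, hμ]; have := hσ n; field_simp
  set q : ℕ → ℝ := fun n => Real.exp (3 * h n) - Real.exp (- h n) with hq
  set m : ℕ → ℕ := fun n => n / k n with hm
  have hm1 : ∀ n : ℕ, 1 ≤ n → 1 ≤ m n := fun n hn =>
    (Nat.one_le_div_iff (hk n hn).1).mpr (hk n hn).2
  have hup : ∀ n : ℕ, 1 ≤ n → R n ≤
      ENNReal.ofReal ((n : ℝ) * σ n ^ 2 * (a n - a n ^ 2 * (1 / (1 + a n)))) := by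
    intro n hn
    rw [← hlin n hn]
    refine iInf₂_le_of_le (linEst n ((a n)⁻¹)) ?_ le_rfl
    unfold linEst
    fun_prop
  have hlo : ∀ n : ℕ, 1 ≤ n → ENNReal.ofReal ((n : ℝ) * σ n ^ 2 * (a n - a n * (q n / (2 * m n))))
      ≤ R n := by
    intro n hn
    refine le_trans (le_of_eq ?_) (lower_mm n (k n) (m n) (hm1 n hn) (Nat.mul_div_le n (k n))
      (σ n) (τ n) (hσ n))
    congr 1
    change _ = k n * τ n ^ 2 - k n * τ n ^ 2 / (2 * m n) * q n
    rw [hkt n hn]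
    ring
  set c : ℕ → ℝ := fun n => (a n - (R n).toReal / (n * σ n ^ 2)) / a n ^ 2 with hc
  have hS : ∀ n : ℕ, 1 ≤ n → 0 < (n : ℝ) * σ n ^ 2 := fun n hn => by
    have h2 : (0 : ℝ) < n := by exact_mod_cast hn
    have := hσ n
    positivity
  have hRt : ∀ n : ℕ, 1 ≤ n → R n ≠ ⊤ := fun n hn =>
    ne_top_of_le_ne_top ENNReal.ofReal_ne_top (hup n hn)
  refine ⟨c, ?_, ?_⟩
  swap
  · filter_upwards [eventually_ge_atTop 1] with n hn
    change R n = _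
    rw [← ENNReal.ofReal_toReal (hRt n hn)]
    congr 1
    simp only [hc]
    have h1 := hapos n hn
    have h2 := hS n hn
    have h3 : (a n - a n ^ 2 * ((a n - (R n).toReal / (n * σ n ^ 2)) / a n ^ 2))
      = (R n).toReal / (n * σ n ^ 2) := by
      field_simp
      ring
    change _ = _ * (a n - _)
    rw [h3, mul_div_cancel₀ _ h2.ne']
  have hx : Tendsto (fun n : ℕ => (n : ℝ) / k n) atTop atTop := by
    have h1 : Tendsto ε atTop (𝓝[>] 0) := tendsto_nhdsWithin_iff.mpr
      ⟨hε0, by filter_upwards [eventually_ge_atTop 1] with n hn using hεpos n hn⟩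
    refine h1.inv_tendsto_nhdsGT_zero.congr fun n => ?_
    simp [hε]
  have hfl : Tendsto (fun n : ℕ => ((n : ℝ) / k n) / m n) atTop (𝓝 1) := by
    have h1 := ((tendsto_nat_floor_div_atTop (R := ℝ)).comp hx).inv₀ one_ne_zero
    rw [inv_one] at h1
    refine h1.congr fun n => ?_
    simp only [Function.comp_apply, Nat.floor_div_eq_div, inv_div, hm]
  have hql : Tendsto (fun n => q n / (4 * h n)) atTop (𝓝 1) := by
    apply lim_q h
    · have := (hμ0.pow 2).div_const 2
      simp only [ne_eq, OfNat.ofNat_ne_zero, not_false_eq_true, zero_pow, zero_div] at this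
      exact this.congr fun n => (hhμ n).symm
    · intro n; rw [hhμ]; have := hμpos n; positivity
  have hupl := hql.mul hfl
  rw [one_mul] at hupl
  refine tendsto_of_tendsto_of_tendsto_of_le_of_le' hlow1 hupl ?_ ?_
  · filter_upwards [eventually_ge_atTop 1] with n hn
    have h1 := hapos n hn
    have h2 := hS n hn
    have h3 : (R n).toReal ≤ (n : ℝ) * σ n ^ 2 * (a n - a n ^ 2 * (1 / (1 + a n))) := by
      refine ENNReal.toReal_le_of_le_ofReal ?_ (hup n hn)
      have : a n - a n ^ 2 * (1 / (1 + a n)) = a n / (1 + a n) := by field_simp; ring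
      rw [this]; positivity
    simp only [hc]
    rw [le_div_iff₀ (by positivity)]
    have h4 : (R n).toReal / (n * σ n ^ 2) ≤ a n - a n ^ 2 * (1 / (1 + a n)) := by
      rw [div_le_iff₀ h2]; linarith
    linarith
  · filter_upwards [eventually_ge_atTop 1] with n hn
    have h1 := hapos n hn
    have h2 := hS n hn
    have h3 : (n : ℝ) * σ n ^ 2 * (a n - a n * (q n / (2 * m n))) ≤ (R n).toReal :=
      (ENNReal.ofReal_le_iff_le_toReal (hRt n hn)).mp (hlo n hn)
    have h4 : a n - a n * (q n / (2 * m n)) ≤ (R n).toReal / (n * σ n ^ 2) := by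
      rw [le_div_iff₀ h2]; linarith
    simp only [hc]
    rw [div_le_iff₀ (by positivity)]
    have h5 : q n / (4 * h n) * (n / k n / m n) * a n ^ 2 = a n * (q n / (2 * m n)) := by
      have e1 : a n = (k n / n : ℝ) * μ n ^ 2 := by simp only [ha, hε]
      rw [hhμ, e1]
      have := hμpos n
      have hk' : (0 : ℝ) < k n := by exact_mod_cast (hk n hn).1
      have hn' : (0 : ℝ) < n := by exact_mod_cast hn
      have hm' : (0 : ℝ) < m n := by exact_mod_cast hm1 n hn
      field_simp
      ring
    linarith
end
end

section
/- Consider the Gaussian sequence model with noise level σₙ and the SNR-aware parameter space Θ(kₙ, τₙ). Suppose εₙ = kₙ/n → 0 and μₙ = τₙ/σₙ → 0 as n → ∞. Then the optimally tuned soft thresholding estimator has supremum risk: inf over λ ≥ 0 of sup over θ ∈ Θ(kₙ,τₙ) of E_θ‖η̂_S(y,λ) − θ‖₂² = n σₙ² ( εₙ μₙ² − exp[ −(1/2)(1/μₙ²)(log(1/εₙ))² (1+o(1)) ] ). -/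
open MeasureTheory ProbabilityTheory Filter
open scoped ENNReal NNReal Topology

noncomputable section

/-- Soft thresholding estimator `[η̂_S(y,λ)]ᵢ = sign(yᵢ)(|yᵢ|−λ)₊`. -/
def softEst (n : ℕ) (lam : ℝ) : (Fin n → ℝ) → Fin n → ℝ :=
  fun y i => Real.sign (y i) * max (|y i| - lam) 0


def sft (l y : ℝ) : ℝ := Real.sign y * max (|y| - l) 0

lemma sft_hi {l y : ℝ} (hl : 0 ≤ l) (h : l ≤ y) : sft l y = y - l := by
  unfold sft
  rcases eq_or_lt_of_le (hl.trans h) with h0 | h0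
  · have : l = 0 := by linarith
    subst this; subst h0; simp
  · rw [Real.sign_of_pos h0, abs_of_pos h0, max_eq_left (by linarith)]; ring

lemma sft_lo {l y : ℝ} (hl : 0 ≤ l) (h : y ≤ -l) : sft l y = y + l := by
  unfold sft
  rcases eq_or_lt_of_le (show y ≤ 0 by linarith) with h0 | h0
  · have : l = 0 := by linarith
    subst this; subst h0; simp
  · rw [Real.sign_of_neg h0, abs_of_neg h0, max_eq_left (by linarith)]; ring

lemma sft_mid {l y : ℝ} (h1 : -l ≤ y) (h2 : y ≤ l) : sft l y = 0 := by
  unfold sft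
  rw [max_eq_right (by have := abs_le.2 ⟨h1, h2⟩; linarith)]; ring

lemma sft_neg (l y : ℝ) : sft l (-y) = - sft l y := by
  unfold sft
  rw [Real.sign_neg, abs_neg]; ring

lemma sft_scale {s : ℝ} (hs : 0 < s) (l y : ℝ) : sft (s * l) (s * y) = s * sft l y := by
  unfold sft
  have h1 : Real.sign (s * y) = Real.sign y := by
    rcases lt_trichotomy y 0 with h | h | h
    · rw [Real.sign_of_neg h, Real.sign_of_neg (mul_neg_of_pos_of_neg hs h)]
    · simp [h]
    · rw [Real.sign_of_pos h, Real.sign_of_pos (mul_pos hs h)]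
  have h2 : max (|s * y| - s * l) 0 = s * max (|y| - l) 0 := by
    rw [abs_mul, abs_of_pos hs, ← mul_sub, mul_max_of_nonneg _ _ hs.le, mul_zero]
  rw [h1, h2]; ring

lemma sft_dist {l : ℝ} (hl : 0 ≤ l) (y : ℝ) : |sft l y - y| ≤ l := by
  rcases le_total l y with h | h
  · rw [sft_hi hl h]; simp [abs_of_nonneg hl]
  · rcases le_total y (-l) with h' | h'
    · rw [sft_lo hl h']; simp [abs_of_nonneg hl]
    · rw [sft_mid h' h]; simpa using abs_le.2 ⟨h', h⟩

lemma sft_meas (l : ℝ) : Measurable (sft l) := by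
  unfold sft
  have : Measurable Real.sign := by
    unfold Real.sign
    exact Measurable.ite (measurableSet_Iio) measurable_const
      (Measurable.ite (measurableSet_Ioi) measurable_const measurable_const)
  fun_prop

/-- monotone comparison -/
lemma pt_basic {l t z : ℝ} (hl : 0 ≤ l) (ht : 0 ≤ t) :
    (sft l (t + z) - t) ^ 2 ≤ sft l z ^ 2 + t ^ 2 ∧ sft l z ^ 2 ≤ (sft l (t + z) - t) ^ 2 := by
  rcases le_total l z with h | h
  · rw [sft_hi hl h, sft_hi hl (by linarith)]
    constructor <;> nlinarith
  · rcases le_total z (-l) with h' | h'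
    · rw [sft_lo hl h']
      rcases le_total l (t + z) with h1 | h1
      · rw [sft_hi hl h1]
        constructor <;> nlinarith
      · rcases le_total (t + z) (-l) with h2 | h2
        · rw [sft_lo hl h2]
          constructor <;> nlinarith
        · rw [sft_mid h2 h1]
          constructor <;> nlinarith
    · rw [sft_mid h' h]
      rcases le_total l (t + z) with h1 | h1
      · rw [sft_hi hl h1]
        constructor <;> nlinarith
      · rw [sft_mid (by linarith) h1]
        constructor <;> nlinarith

lemma pt_upper {l t z m : ℝ} (hl : 0 ≤ l) (ht : 0 ≤ t) (hm : 0 ≤ m) :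
    (sft l (t + z) - t) ^ 2 ≤
      sft l z ^ 2 + t ^ 2 - (t ^ 2 - m ^ 2) * (Set.Ioi (l - m)).indicator 1 z := by
  by_cases hz : z ∈ Set.Ioi (l - m)
  · rw [Set.indicator_of_mem hz]
    simp only [Pi.one_apply, mul_one]
    rw [Set.mem_Ioi] at hz
    rcases le_total t m with h | h
    · have := (pt_basic (z := z) hl ht).1
      nlinarith
    · rw [sft_hi hl (show l ≤ t + z by linarith)]
      rcases le_total l z with h1 | h1
      · rw [sft_hi hl h1]; nlinarith
      · rcases le_total z (-l) with h' | h'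
        · rw [sft_lo hl h']; nlinarith
        · rw [sft_mid h' h1]; nlinarith
  · rw [Set.indicator_of_notMem hz]
    simpa using (pt_basic (z := z) hl ht).1

lemma pt_lower {l t z : ℝ} (hl : 0 ≤ l) (ht : 0 ≤ t) :
    sft l z ^ 2 + t ^ 2 - t ^ 2 * ((Set.Ioi (l - t)).indicator 1 z +
      (Set.Ioi (l - t)).indicator 1 (-z)) ≤ (sft l (t + z) - t) ^ 2 := by
  have hb := (pt_basic (z := z) hl ht).2
  have hsq := sq_nonneg t
  by_cases hz : z ∈ Set.Ioi (l - t) <;> by_cases hz' : -z ∈ Set.Ioi (l - t)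
  · rw [Set.indicator_of_mem hz, Set.indicator_of_mem hz']
    simp only [Pi.one_apply]; nlinarith
  · rw [Set.indicator_of_mem hz, Set.indicator_of_notMem hz']
    simp only [Pi.one_apply]; nlinarith
  · rw [Set.indicator_of_notMem hz, Set.indicator_of_mem hz']
    simp only [Pi.one_apply]; nlinarith
  · rw [Set.indicator_of_notMem hz, Set.indicator_of_notMem hz']
    rw [Set.mem_Ioi, not_lt] at hz hz'
    rw [sft_mid (show -l ≤ t + z by linarith) (by linarith), sft_mid (show -l ≤ z by linarith) (by linarith)]
    nlinarith

abbrev gam : Measure ℝ := gaussianReal 0 1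

def phi (x : ℝ) : ℝ := (√(2 * Real.pi))⁻¹ * Real.exp (-x ^ 2 / 2)

lemma phi_eq (x : ℝ) : gaussianPDFReal 0 1 x = phi x := by
  simp [gaussianPDFReal, phi]

lemma phi_pos (x : ℝ) : 0 < phi x := by unfold phi; positivity

lemma phi_le (x : ℝ) : phi x ≤ Real.exp (-x ^ 2 / 2) := by
  unfold phi
  have : (√(2 * Real.pi))⁻¹ ≤ 1 := by
    apply inv_le_one_of_one_le₀
    rw [Real.one_le_sqrt]
    linarith [Real.pi_gt_three]
  exact mul_le_of_le_one_left (Real.exp_pos _).le this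

lemma phi_anti {x y : ℝ} (hx : 0 ≤ x) (h : x ≤ y) : phi y ≤ phi x := by
  unfold phi
  gcongr

lemma phi_tilt (x z : ℝ) : phi z ≤ phi x * Real.exp (-(x * (z - x))) := by
  unfold phi
  rw [mul_assoc, ← Real.exp_add]
  gcongr
  nlinarith [sq_nonneg (z - x)]

def Qf (x : ℝ) : ℝ := gam.real (Set.Ioi x)

lemma gam_int (f : ℝ → ℝ) : ∫ z, f z ∂gam = ∫ z, phi z * f z := by
  rw [integral_gaussianReal_eq_integral_smul (by norm_num)]
  simp [phi_eq]

lemma Qf_nonneg (x : ℝ) : 0 ≤ Qf x := measureReal_nonneg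
lemma Qf_le_one (x : ℝ) : Qf x ≤ 1 := measureReal_le_one

lemma phi_integrable : Integrable phi := by
  have := integrable_gaussianPDFReal 0 1
  rwa [show gaussianPDFReal 0 1 = phi from funext phi_eq] at this

lemma gam_real (s : Set ℝ) : gam.real s = ∫ z in s, phi z := by
  rw [measureReal_def, gaussianReal_apply_eq_integral 0 (by norm_num)]
  simp_rw [phi_eq]
  rw [ENNReal.toReal_ofReal (integral_nonneg fun z => (phi_pos z).le)]

lemma Qf_lower {x b : ℝ} (hx : 0 ≤ x) (hb : 0 ≤ b) : b * phi (x + b) ≤ Qf x := by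
  have h1 : gam.real (Set.Ioc x (x + b)) ≤ Qf x := by
    apply measureReal_mono (Set.Ioc_subset_Ioi_self)
  refine le_trans ?_ h1
  rw [gam_real]
  have : ∫ z in Set.Ioc x (x + b), phi (x + b) = b * phi (x + b) := by
    simp [hb]
  rw [← this]
  apply setIntegral_mono_on (by simp) phi_integrable.integrableOn measurableSet_Ioc
  intro z hz
  exact phi_anti (hx.trans hz.1.le) hz.2

lemma Qf_upper {x : ℝ} (hx : 0 < x) : Qf x ≤ phi x / x := by
  unfold Qf
  rw [gam_real]
  have hi : IntegrableOn (fun z => Real.exp (-x * z)) (Set.Ioi x) := integrableOn_exp_mul_Ioi (by linarith) x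
  have : ∫ z in Set.Ioi x, phi x * Real.exp (x * x) * Real.exp (-x * z) = phi x / x := by
    rw [integral_const_mul, integral_exp_mul_Ioi (by linarith)]
    have : Real.exp (x * x) * Real.exp (-x * x) = 1 := by
      rw [← Real.exp_add]; simp
    rw [div_eq_mul_inv, div_eq_mul_inv, show phi x * Real.exp (x * x) * (-Real.exp (-x * x) * (-x)⁻¹) =
      phi x * (Real.exp (x * x) * Real.exp (-x * x)) * x⁻¹ by rw [inv_neg]; ring, this, mul_one]
  rw [← this]
  apply setIntegral_mono_on phi_integrable.integrableOn (hi.const_mul _) measurableSet_Ioi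
  intro z hz
  rw [mul_assoc, ← Real.exp_add]
  rw [show x * x + -x * z = -(x * (z - x)) by ring]
  exact phi_tilt x z

lemma gam_neg (f : ℝ → ℝ) : ∫ z, f (-z) ∂gam = ∫ z, f z ∂gam := by
  have h : gam.map (fun x => -x) = gam := by
    have := gaussianReal_map_neg (μ := 0) (v := 1)
    simpa using this
  conv_rhs => rw [← h]
  exact (MeasurableEquiv.neg ℝ).measurableEmbedding.integral_map f |>.symm

lemma loss_int {l : ℝ} (hl : 0 ≤ l) (t : ℝ) : Integrable (fun z => (sft l (t + z) - t) ^ 2) gam := by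
  have h2 : MemLp (fun z : ℝ => z) 2 gam := memLp_id_gaussianReal 2
  have h3 : MemLp (fun z : ℝ => |z| + l) 2 gam := h2.abs.add (memLp_const l)
  have h4 : MemLp (fun z => sft l (t + z) - t) 2 gam := by
    refine h3.of_le ?_ ?_
    · exact ((sft_meas l).comp (measurable_const.add measurable_id)).sub_const t |>.aestronglyMeasurable
    · refine Eventually.of_forall fun z => ?_
      have := sft_dist hl (t + z)
      rw [Real.norm_eq_abs, Real.norm_eq_abs, abs_of_nonneg (by positivity : 0 ≤ |z| + l)]
      calc |sft l (t + z) - t| = |z + (sft l (t + z) - (t + z))| := by congr 1; ring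
        _ ≤ |z| + |sft l (t + z) - (t + z)| := abs_add_le _ _
        _ ≤ _ := by linarith
  exact h4.integrable_sq

def rho (l t : ℝ) : ℝ := ∫ z, (sft l (t + z) - t) ^ 2 ∂gam

lemma rho_zero (l : ℝ) : rho l 0 = ∫ z, sft l z ^ 2 ∂gam := by simp [rho]

lemma rho_nonneg (l t : ℝ) : 0 ≤ rho l t := integral_nonneg fun z => sq_nonneg _

lemma rho_neg (l t : ℝ) : rho l (-t) = rho l t := by
  unfold rho
  rw [← gam_neg]
  congr 1; ext z
  rw [← neg_add, sft_neg]; ring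

lemma rho_upper {l t m : ℝ} (hl : 0 ≤ l) (hm : 0 ≤ m) :
    rho l t ≤ rho l 0 + t ^ 2 - (t ^ 2 - m ^ 2) * Qf (l - m) := by
  wlog ht : 0 ≤ t generalizing t
  · have := this (t := -t) (by linarith)
    rw [rho_neg] at this
    simpa using this
  have i0 : Integrable (fun z => sft l z ^ 2) gam := by simpa using loss_int hl 0
  have i1 : Integrable ((Set.Ioi (l - m)).indicator (1 : ℝ → ℝ)) gam :=
    (integrable_const (1 : ℝ)).indicator measurableSet_Ioi
  have e : ∫ z, (sft l z ^ 2 + t ^ 2 - (t ^ 2 - m ^ 2) * (Set.Ioi (l - m)).indicator 1 z) ∂gam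
      = rho l 0 + t ^ 2 - (t ^ 2 - m ^ 2) * Qf (l - m) := by
    have i3 : Integrable (fun z => sft l z ^ 2 + t ^ 2) gam := i0.add (integrable_const _)
    rw [integral_sub i3 (i1.const_mul _),
      integral_add i0 (integrable_const _), integral_const_mul, integral_indicator_one measurableSet_Ioi, rho_zero]
    simp [Qf]
  rw [← e]
  exact integral_mono (loss_int hl t) ((i0.add (integrable_const _)).sub (i1.const_mul _))
    fun z => pt_upper hl ht hm

lemma rho_lower {l t : ℝ} (hl : 0 ≤ l) (ht : 0 ≤ t) :
    rho l 0 + t ^ 2 - 2 * t ^ 2 * Qf (l - t) ≤ rho l t := by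
  have i0 : Integrable (fun z => sft l z ^ 2) gam := by simpa using loss_int hl 0
  have i1 : Integrable ((Set.Ioi (l - t)).indicator (1 : ℝ → ℝ)) gam :=
    (integrable_const (1 : ℝ)).indicator measurableSet_Ioi
  have i2 : Integrable (fun z => (Set.Ioi (l - t)).indicator (1 : ℝ → ℝ) (-z)) gam := by
    have : (fun z => (Set.Ioi (l - t)).indicator (1 : ℝ → ℝ) (-z)) =
       (Set.Iio (-(l - t))).indicator (fun _ => (1 : ℝ)) := by
      ext z
      simp only [Set.indicator, Set.mem_Ioi, Set.mem_Iio, lt_neg, Pi.one_apply]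
    rw [this]
    exact (integrable_const (1 : ℝ)).indicator measurableSet_Iio
  have e : ∫ z, (sft l z ^ 2 + t ^ 2 - t ^ 2 * ((Set.Ioi (l - t)).indicator 1 z +
      (Set.Ioi (l - t)).indicator 1 (-z))) ∂gam
      = rho l 0 + t ^ 2 - 2 * t ^ 2 * Qf (l - t) := by
    have i3 : Integrable (fun z => sft l z ^ 2 + t ^ 2) gam := i0.add (integrable_const _)
    have i4 : Integrable (fun z => t ^ 2 * ((Set.Ioi (l - t)).indicator (1 : ℝ → ℝ) z +
      (Set.Ioi (l - t)).indicator (1 : ℝ → ℝ) (-z))) gam := (i1.add i2).const_mul _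
    rw [integral_sub i3 i4,
      integral_add i0 (integrable_const _), integral_const_mul, integral_add i1 i2,
      gam_neg ((Set.Ioi (l - t)).indicator (1 : ℝ → ℝ)),
      integral_indicator_one measurableSet_Ioi, rho_zero]
    simp [Qf]; ring
  rw [← e]
  exact integral_mono ((i0.add (integrable_const _)).sub ((i1.add i2).const_mul _)) (loss_int hl t)
    fun z => pt_lower hl ht

lemma rho0_lower {l b : ℝ} (hl : 0 ≤ l) (hb : 0 ≤ b) : b ^ 3 * phi (l + 2 * b) ≤ rho l 0 := by
  have i0 : Integrable (fun z => sft l z ^ 2) gam := by simpa using loss_int hl 0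
  have i1 : Integrable ((Set.Ioi (l + b)).indicator (1 : ℝ → ℝ)) gam :=
    (integrable_const (1 : ℝ)).indicator measurableSet_Ioi
  have h1 : b ^ 2 * Qf (l + b) ≤ rho l 0 := by
    rw [rho_zero]
    have : ∫ z, b ^ 2 * (Set.Ioi (l + b)).indicator 1 z ∂gam = b ^ 2 * Qf (l + b) := by
      rw [integral_const_mul, integral_indicator_one measurableSet_Ioi]; rfl
    rw [← this]
    refine integral_mono (i1.const_mul _) i0 fun z => ?_
    by_cases hz : z ∈ Set.Ioi (l + b)
    · simp only [Set.indicator_of_mem hz, Pi.one_apply, mul_one]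
      rw [Set.mem_Ioi] at hz
      rw [sft_hi hl (by linarith)]
      nlinarith
    · simp only [Set.indicator_of_notMem hz, mul_zero]
      positivity
  have h2 := Qf_lower (x := l + b) (b := b) (by linarith) hb
  calc b ^ 3 * phi (l + 2 * b) = b ^ 2 * (b * phi (l + b + b)) := by
        rw [show l + b + b = l + 2 * b by ring]; ring
    _ ≤ b ^ 2 * Qf (l + b) := by gcongr
    _ ≤ _ := h1

lemma gamma_int {l : ℝ} (hl : 0 < l) :
    ∫ u, (Set.Ioi (0:ℝ)).indicator (fun u => u ^ 2 * Real.exp (-(l * u))) u = 2 / l ^ 3 ∧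
    Integrable ((Set.Ioi (0:ℝ)).indicator (fun u => u ^ 2 * Real.exp (-(l * u)))) := by
  have h := Real.integral_rpow_mul_exp_neg_mul_Ioi (a := 3) (r := l) (by norm_num) hl
  have hG : Real.Gamma 3 = 2 := by
    have := Real.Gamma_nat_eq_factorial 2
    norm_num at this
    simpa [Nat.factorial] using this
  have h' : ∫ u in Set.Ioi (0:ℝ), u ^ 2 * Real.exp (-(l * u)) = 2 / l ^ 3 := by
    rw [hG] at h
    norm_num at h
    rw [h]
    norm_cast
    field_simp
  constructor
  · rw [integral_indicator measurableSet_Ioi, h']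
  · rw [integrable_indicator_iff measurableSet_Ioi]
    by_contra hc
    rw [integral_undef hc] at h'
    have : 0 < 2 / l ^ 3 := by positivity
    linarith

lemma rho0_upper {l : ℝ} (hl : 0 < l) : rho l 0 ≤ 4 * phi l / l ^ 3 := by
  obtain ⟨g1, g2⟩ := gamma_int hl
  set F := (Set.Ioi (0:ℝ)).indicator (fun u => u ^ 2 * Real.exp (-(l * u))) with hF
  have hF0 : ∀ u, 0 ≤ F u := fun u => by
    rw [hF]; apply Set.indicator_nonneg; intro x _; positivity
  have iF1 : Integrable (fun z => phi l * F (z - l)) := (g2.comp_sub_right l).const_mul _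
  have iF2 : Integrable (fun z => phi l * F (-z - l)) := by
    simpa using iF1.comp_neg
  have e1 : ∫ z, phi l * F (z - l) = phi l * (2 / l ^ 3) := by
    rw [integral_const_mul, integral_sub_right_eq_self F l, g1]
  have e2 : ∫ z, phi l * F (-z - l) = phi l * (2 / l ^ 3) := by
    rw [← e1]
    exact integral_neg_eq_self (fun z => phi l * F (z - l)) volume
  have e : ∫ z, (phi l * F (z - l) + phi l * F (-z - l)) = 4 * phi l / l ^ 3 := by
    rw [integral_add iF1 iF2, e1, e2]; ring
  rw [rho_zero, gam_int, ← e]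
  have key : ∀ z, l < z → phi z * (z - l) ^ 2 ≤ phi l * F (z - l) := by
    intro z hz
    rw [hF, Set.indicator_of_mem (by simpa using hz)]
    calc _ ≤ (phi l * Real.exp (-(l * (z - l)))) * (z - l) ^ 2 := by
          gcongr; exact phi_tilt l z
      _ = _ := by ring
  refine integral_mono_of_nonneg ?_ (iF1.add iF2) ?_
  · exact Eventually.of_forall fun z => mul_nonneg (phi_pos z).le (sq_nonneg _)
  · refine Eventually.of_forall fun z => ?_
    have a1 := mul_nonneg (phi_pos l).le (hF0 (z - l))
    have a2 := mul_nonneg (phi_pos l).le (hF0 (-z - l))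
    simp only
    rcases lt_or_ge l z with h | h
    · rw [sft_hi hl.le h.le]
      have := key z h
      linarith
    · rcases lt_or_ge z (-l) with h' | h'
      · rw [sft_lo hl.le h'.le]
        have := key (-z) (by linarith)
        have e3 : phi (-z) = phi z := by simp [phi]
        rw [e3] at this
        have e4 : (-z - l) ^ 2 = (z + l) ^ 2 := by ring
        rw [e4] at this
        linarith
      · rw [sft_mid h' h]; simp; linarith

lemma coord_risk {s l : ℝ} (hs : 0 < s) (hl : 0 ≤ l) (t : ℝ) :
    ∫⁻ y, ENNReal.ofReal ((sft (s * l) y - t) ^ 2) ∂(gaussianReal t ((s ^ 2).toNNReal)) =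
      ENNReal.ofReal (s ^ 2 * rho l (t / s)) := by
  have hmap : gaussianReal t ((s ^ 2).toNNReal) = gam.map (fun z => t + s * z) := by
    have h1 := gaussianReal_map_const_mul (μ := 0) (v := 1) s
    have h2 := gaussianReal_map_const_add (μ := 0) (v := (s ^ 2).toNNReal) t
    have h3 : NNReal.mk (s ^ 2) (sq_nonneg s) * 1 = (s ^ 2).toNNReal := by
      rw [mul_one]; ext; simp [Real.coe_toNNReal, sq_nonneg]
    rw [h3, mul_zero] at h1
    rw [← h1, Measure.map_map (by fun_prop) (by fun_prop), zero_add] at h2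
    rw [← h2]; rfl
  rw [hmap, lintegral_map (by have := sft_meas (s * l); fun_prop) (by fun_prop)]
  have hp : ∀ z, (sft (s * l) (t + s * z) - t) ^ 2 = s ^ 2 * (sft l (t / s + z) - t / s) ^ 2 := by
    intro z
    have : t + s * z = s * (t / s + z) := by field_simp
    rw [this, sft_scale hs]
    field_simp
  simp_rw [hp]
  unfold rho
  rw [← integral_const_mul]
  rw [ofReal_integral_eq_lintegral_ofReal ((loss_int hl (t / s)).const_mul _)]
  exact Eventually.of_forall fun z => by positivity

lemma risk_eq {n : ℕ} {s l : ℝ} (hs : 0 < s) (hl : 0 ≤ l) (θ : Fin n → ℝ) :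
    risk n s (softEst n (s * l)) θ = ENNReal.ofReal (s ^ 2 * ∑ i, rho l (θ i / s)) := by
  unfold risk gsm
  have h1 : ∀ y : Fin n → ℝ, ENNReal.ofReal (∑ i, (softEst n (s * l) y i - θ i) ^ 2) =
      ∑ i, ENNReal.ofReal ((sft (s * l) (y i) - θ i) ^ 2) := by
    intro y
    rw [ENNReal.ofReal_sum_of_nonneg (fun i _ => sq_nonneg _)]
    rfl
  simp_rw [h1]
  have hm := sft_meas (s * l)
  rw [lintegral_finsetSum _ (fun i _ => by fun_prop)]
  rw [Finset.mul_sum, ENNReal.ofReal_sum_of_nonneg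
    (fun i _ => mul_nonneg (sq_nonneg _) (rho_nonneg _ _))]
  refine Finset.sum_congr rfl fun i _ => ?_
  rw [← coord_risk hs hl]
  exact (measurePreserving_eval (fun i => gaussianReal (θ i) ((s ^ 2).toNNReal)) i).lintegral_comp
    (f := fun y => ENNReal.ofReal ((sft (s * l) y - θ i) ^ 2)) (by fun_prop)

lemma sup_upper {n k : ℕ} {s l m τ : ℝ} (hs : 0 < s) (hl : 0 ≤ l) (hm : 0 ≤ m)
    {θ : Fin n → ℝ} (hθ : θ ∈ paramSet n k τ) :
    risk n s (softEst n (s * l)) θ ≤ ENNReal.ofReal (s ^ 2 *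
      (k * (τ / s) ^ 2 - (k * ((τ / s) ^ 2 - m ^ 2) * Qf (l - m) - n * rho l 0))) := by
  classical
  rw [risk_eq hs hl]
  apply ENNReal.ofReal_le_ofReal
  gcongr
  obtain ⟨h1, h2⟩ := hθ
  set S : Finset (Fin n) := Finset.univ.filter (fun i => θ i ≠ 0) with hS
  have hc : S.card ≤ k := by
    rw [← Set.ncard_coe_finset]
    simpa [hS] using h1
  have hc' : (S.card : ℝ) ≤ k := by exact_mod_cast hc
  set q := Qf (l - m) with hq
  have q0 : 0 ≤ q := Qf_nonneg _
  have q1 : q ≤ 1 := Qf_le_one _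
  have hb : ∀ i, rho l (θ i / s) ≤ rho l 0 + (1 - q) * (θ i / s) ^ 2 + (if θ i ≠ 0 then m ^ 2 * q else 0) := by
    intro i
    by_cases h : θ i = 0
    · simp [h]
    · have := rho_upper (t := θ i / s) hl hm
      simp only [ne_eq, h, not_false_eq_true, if_true]
      nlinarith
  have hsum : ∑ i, (θ i / s) ^ 2 ≤ k * (τ / s) ^ 2 := by
    simp_rw [div_pow]
    rw [← Finset.sum_div, ← mul_div_assoc]
    gcongr
  calc ∑ i, rho l (θ i / s) ≤ ∑ i, (rho l 0 + (1 - q) * (θ i / s) ^ 2 + (if θ i ≠ 0 then m ^ 2 * q else 0)) :=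
        Finset.sum_le_sum fun i _ => hb i
    _ = n * rho l 0 + (1 - q) * ∑ i, (θ i / s) ^ 2 + S.card * (m ^ 2 * q) := by
        rw [Finset.sum_add_distrib, Finset.sum_add_distrib, ← Finset.mul_sum, ← Finset.sum_filter]
        simp [hS]
    _ ≤ n * rho l 0 + (1 - q) * (k * (τ / s) ^ 2) + k * (m ^ 2 * q) := by
        have : 0 ≤ 1 - q := by linarith
        gcongr
    _ = _ := by ring

lemma sup_lower {n k : ℕ} {s l τ : ℝ} (hs : 0 < s) (hl : 0 ≤ l) (hτ : 0 < τ) (hk : k ≤ n) :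
    ∃ θ ∈ paramSet n k τ, ENNReal.ofReal (s ^ 2 *
      (k * (τ / s) ^ 2 - (2 * k * (τ / s) ^ 2 * Qf (l - τ / s) - n * rho l 0))) ≤
      risk n s (softEst n (s * l)) θ := by
  classical
  obtain ⟨S, -, hS⟩ := Finset.exists_subset_card_eq (s := (Finset.univ : Finset (Fin n))) (n := k)
    (by simpa using hk)
  refine ⟨fun i => if i ∈ S then τ else 0, ⟨?_, ?_⟩, ?_⟩
  · have : {i : Fin n | (if i ∈ S then τ else 0) ≠ 0} = (S : Set (Fin n)) := by
      ext i; simp [hτ.ne']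
    rw [this, Set.ncard_coe_finset, hS]
  · simp [ite_pow, hS]
  · rw [risk_eq hs hl]
    apply ENNReal.ofReal_le_ofReal
    gcongr
    have h1 := rho_lower (t := τ / s) hl (by positivity)
    have : ∀ i : Fin n, rho l 0 + (if i ∈ S then (τ / s) ^ 2 - 2 * (τ / s) ^ 2 * Qf (l - τ / s) else 0) ≤
        rho l ((if i ∈ S then τ else 0) / s) := by
      intro i
      by_cases h : i ∈ S
      · simp only [h, if_true]; linarith
      · simp [h]
    refine le_trans (le_of_eq ?_) (Finset.sum_le_sum fun i _ => this i)
    rw [Finset.sum_add_distrib]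
    simp [hS]
    ring

lemma D_up {η μ L : ℝ} (hη : 0 < η) (hμ : 0 < μ) (hμ1 : μ ≤ 1) (hL : 0 < L)
    (h1 : 1 ≤ (1 + η) ^ 2 * L / μ)
    (h2 : 5 ≤ (1 - ((1 + η) ^ 2)⁻¹) * Real.exp (-2) * (1 + η) ^ 4 * L ^ 2 * Real.exp (η * L))
    (h3 : ((1 + η) ^ 2 * L / μ) ^ 3 ≤
      (√(2 * Real.pi))⁻¹ * Real.exp (η / 2 * ((1 + η) ^ 2 * L / μ) ^ 2)) :
    Real.exp (-(1 / 2) * (1 + η) * ((1 + η) ^ 2 * L / μ) ^ 2) ≤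
      Real.exp (-L) * (μ ^ 2 - (μ / (1 + η)) ^ 2) * Qf ((1 + η) ^ 2 * L / μ - μ / (1 + η))
        - rho ((1 + η) ^ 2 * L / μ) 0 := by
  set l := (1 + η) ^ 2 * L / μ with hl
  set m := μ / (1 + η) with hm
  have hl0 : 0 < l := by linarith
  have hm0 : 0 < m := by positivity
  have hmμ : m ≤ μ := div_le_self hμ.le (by linarith)
  have hml : l * m = (1 + η) * L := by rw [hl, hm]; field_simp
  have hmul : l * μ = (1 + η) ^ 2 * L := by rw [hl]; field_simp
  have hκ : μ ^ 2 - m ^ 2 = (1 - ((1 + η) ^ 2)⁻¹) * μ ^ 2 := by rw [hm]; field_simp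
  have hr := rho0_upper hl0
  have hq := Qf_lower (x := l - m) (b := l⁻¹) (by linarith) (by positivity)
  have hphi : phi l * Real.exp (l * m - 2) ≤ phi (l - m + l⁻¹) := by
    unfold phi
    rw [mul_assoc, ← Real.exp_add]
    gcongr
    have e1 : l * l⁻¹ = 1 := mul_inv_cancel₀ hl0.ne'
    have e2 : l⁻¹ ≤ 1 := inv_le_one_of_one_le₀ h1
    have e3 : 0 < l⁻¹ := by positivity
    have e4 : (l - m + l⁻¹) ^ 2 = l ^ 2 - 2 * (l * m) + m ^ 2 + 2 * (l * l⁻¹) - 2 * (m * l⁻¹) + l⁻¹ ^ 2 := by ring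
    have e5 : 0 < m * l⁻¹ := by positivity
    rw [e4, e1]
    nlinarith
  have hdiff : 0 ≤ μ ^ 2 - m ^ 2 := by nlinarith
  have step1 : Real.exp (-L) * (μ ^ 2 - m ^ 2) * (l⁻¹ * (phi l * Real.exp (l * m - 2))) ≤
      Real.exp (-L) * (μ ^ 2 - m ^ 2) * Qf (l - m) := by
    refine mul_le_mul_of_nonneg_left (le_trans ?_ hq) (mul_nonneg (Real.exp_pos _).le hdiff)
    gcongr
  have hexp : Real.exp (-L) * Real.exp (l * m - 2) = Real.exp (-2) * Real.exp (η * L) := by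
    rw [← Real.exp_add, ← Real.exp_add, hml]; congr 1; ring
  have step2 : Real.exp (-L) * (μ ^ 2 - m ^ 2) * (l⁻¹ * (phi l * Real.exp (l * m - 2))) =
      phi l / l ^ 3 * ((1 - ((1 + η) ^ 2)⁻¹) * Real.exp (-2) * (1 + η) ^ 4 * L ^ 2 * Real.exp (η * L)) := by
    have : (1 + η) ^ 4 * L ^ 2 = (l * μ) ^ 2 := by rw [hmul]; ring
    calc _ = (μ ^ 2 - m ^ 2) * l⁻¹ * phi l * (Real.exp (-L) * Real.exp (l * m - 2)) := by ring
      _ = phi l / l ^ 3 * ((1 - ((1 + η) ^ 2)⁻¹) * Real.exp (-2) * ((l * μ) ^ 2) * Real.exp (η * L)) := by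
        rw [hexp, hκ]; field_simp
      _ = _ := by rw [← this]; ring
  have step3 : phi l / l ^ 3 * 5 ≤ Real.exp (-L) * (μ ^ 2 - m ^ 2) * Qf (l - m) := by
    refine le_trans ?_ step1
    rw [step2]
    have := phi_pos l
    gcongr
  have step4 : Real.exp (-(1 / 2) * (1 + η) * l ^ 2) ≤ phi l / l ^ 3 := by
    rw [le_div_iff₀ (by positivity)]
    calc _ ≤ Real.exp (-(1 / 2) * (1 + η) * l ^ 2) * ((√(2 * Real.pi))⁻¹ * Real.exp (η / 2 * l ^ 2)) := by gcongr
      _ = (√(2 * Real.pi))⁻¹ * (Real.exp (-(1 / 2) * (1 + η) * l ^ 2) * Real.exp (η / 2 * l ^ 2)) := by ring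
      _ = phi l := by
        rw [← Real.exp_add]; unfold phi; congr 2; ring
  have : 4 * phi l / l ^ 3 = phi l / l ^ 3 * 4 := by ring
  linarith

lemma D_low {δ μ L : ℝ} (hδ : 0 < δ) (hμ : 0 < μ) (hμ1 : μ ≤ 1) (hL : 0 < L)
    (h1 : μ ^ 2 ≤ δ * L) (h2 : 1 ≤ (1 - 2 * δ) * L / μ) (h3 : 2 * Real.exp (-L) ≤ phi 4)
    (h4 : 4 * (L ^ 2 * Real.exp (-(δ * L))) ≤ Real.exp (-3)) {l : ℝ} (hl : 0 ≤ l) :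
    2 * Real.exp (-L) * μ ^ 2 * Qf (l - μ) - rho l 0 ≤
      Real.exp (-(1 / 2) * ((1 - 2 * δ) * L / μ) ^ 2) := by
  have hr := rho_nonneg l 0
  have hQ0 := Qf_nonneg (l - μ)
  have hQ1 := Qf_le_one (l - μ)
  have hμ2 : μ ^ 2 ≤ 1 := by nlinarith
  have hE := Real.exp_pos (-L)
  rcases le_or_gt ((1 - δ) * L / μ) l with hc | hc
  · have hx : (1 - 2 * δ) * L / μ ≤ l - μ := by
      have : (1 - 2 * δ) * L / μ + μ ≤ (1 - δ) * L / μ := by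
        rw [div_add' _ _ _ hμ.ne']
        gcongr
        nlinarith
      linarith
    set x := l - μ with hxd
    have hx1 : 1 ≤ x := by linarith
    have hq : Qf x ≤ Real.exp (-x ^ 2 / 2) := by
      refine (Qf_upper (by linarith)).trans ((div_le_self (phi_pos _).le hx1).trans (phi_le x))
    have h5 : Real.exp (-x ^ 2 / 2) ≤ Real.exp (-(1 / 2) * ((1 - 2 * δ) * L / μ) ^ 2) := by
      gcongr
      nlinarith
    have h6 : 2 * Real.exp (-L) * μ ^ 2 ≤ 1 := by
      have : phi 4 ≤ 1 := (phi_le 4).trans (Real.exp_le_one_iff.2 (by norm_num))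
      calc 2 * Real.exp (-L) * μ ^ 2 ≤ 1 * 1 := by
            gcongr; linarith
        _ = 1 := by norm_num
    have : 2 * Real.exp (-L) * μ ^ 2 * Qf x ≤ Qf x := mul_le_of_le_one_left hQ0 h6
    linarith
  · suffices 2 * Real.exp (-L) * μ ^ 2 * Qf (l - μ) ≤ rho l 0 by
      have := Real.exp_pos (-(1 / 2) * ((1 - 2 * δ) * L / μ) ^ 2)
      linarith
    rcases le_or_gt l 2 with hl2 | hl2
    · have := rho0_lower (b := 1) hl zero_le_one
      have h5 : phi 4 ≤ phi (l + 2 * 1) := phi_anti (by linarith) (by linarith)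
      calc 2 * Real.exp (-L) * μ ^ 2 * Qf (l - μ) ≤ phi 4 * 1 * 1 := by
            have := phi_pos 4
            gcongr
        _ ≤ _ := by linarith
    · have hl0 : 0 < l := by linarith
      have hlow := rho0_lower (b := l⁻¹) hl (by positivity)
      have e1 : l * l⁻¹ = 1 := mul_inv_cancel₀ hl0.ne'
      have e3 : 0 < l⁻¹ := by positivity
      have e2 : l⁻¹ ≤ 1 / 2 := by
        rw [inv_le_comm₀ hl0 (by norm_num)]; norm_num; linarith
      have hp : phi l * Real.exp (-3) ≤ phi (l + 2 * l⁻¹) := by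
        unfold phi
        rw [mul_assoc, ← Real.exp_add]
        gcongr
        have : (l + 2 * l⁻¹) ^ 2 = l ^ 2 + 4 * (l * l⁻¹) + 4 * l⁻¹ ^ 2 := by ring
        rw [this, e1]
        nlinarith
      have hx : l / 2 ≤ l - μ := by linarith
      have hq := Qf_upper (x := l - μ) (by linarith)
      have hpq : phi (l - μ) ≤ phi l * Real.exp (l * μ) := by
        unfold phi
        rw [mul_assoc, ← Real.exp_add]
        gcongr
        nlinarith
      have hq2 : Qf (l - μ) ≤ 2 * l⁻¹ * (phi l * Real.exp (l * μ)) := by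
        refine hq.trans ?_
        calc phi (l - μ) / (l - μ) ≤ (phi l * Real.exp (l * μ)) / (l / 2) := by
              have := phi_pos l
              gcongr
          _ = _ := by field_simp
      have hlμ : l * μ ≤ (1 - δ) * L := by
        rw [lt_div_iff₀ hμ] at hc; exact hc.le
      have hlμL : l * μ ≤ L := by nlinarith
      have hphi := phi_pos l
      calc 2 * Real.exp (-L) * μ ^ 2 * Qf (l - μ)
          ≤ 2 * Real.exp (-L) * μ ^ 2 * (2 * l⁻¹ * (phi l * Real.exp (l * μ))) := by gcongr
        _ = l⁻¹ ^ 3 * phi l * (4 * ((l * μ) ^ 2 * (Real.exp (-L) * Real.exp (l * μ)))) := by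
            field_simp; ring
        _ ≤ l⁻¹ ^ 3 * phi l * (4 * (L ^ 2 * Real.exp (-(δ * L)))) := by
            rw [← Real.exp_add]
            gcongr
            linarith
        _ ≤ l⁻¹ ^ 3 * phi l * Real.exp (-3) := by gcongr
        _ = l⁻¹ ^ 3 * (phi l * Real.exp (-3)) := by ring
        _ ≤ l⁻¹ ^ 3 * phi (l + 2 * l⁻¹) := by gcongr
        _ ≤ _ := hlow

def Rn (n k : ℕ) (τ σ : ℝ) : ℝ≥0∞ :=
  ⨅ (lam : ℝ) (_ : 0 ≤ lam), ⨆ θ ∈ paramSet n k τ, risk n σ (softEst n lam) θ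

lemma Rn_upper {n k : ℕ} {τ σ ε μ L η : ℝ} (hn : 0 < n) (hσ : 0 < σ)
    (hε : ε = (k : ℝ) / n) (hμe : μ = τ / σ) (hL' : ε = Real.exp (-L))
    (hη : 0 < η) (hμ : 0 < μ) (hμ1 : μ ≤ 1) (hL : 0 < L)
    (h1 : 1 ≤ (1 + η) ^ 2 * L / μ)
    (h2 : 5 ≤ (1 - ((1 + η) ^ 2)⁻¹) * Real.exp (-2) * (1 + η) ^ 4 * L ^ 2 * Real.exp (η * L))
    (h3 : ((1 + η) ^ 2 * L / μ) ^ 3 ≤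
      (√(2 * Real.pi))⁻¹ * Real.exp (η / 2 * ((1 + η) ^ 2 * L / μ) ^ 2)) :
    Rn n k τ σ ≤ ENNReal.ofReal ((n : ℝ) * σ ^ 2 * (ε * μ ^ 2 -
      Real.exp (-(1 / 2) * (1 + η) * ((1 + η) ^ 2 * L / μ) ^ 2))) ∧
    Real.exp (-(1 / 2) * (1 + η) * ((1 + η) ^ 2 * L / μ) ^ 2) ≤ ε * μ ^ 2 := by
  have key := D_up hη hμ hμ1 hL h1 h2 h3
  rw [← hL'] at key
  have hε0 : 0 < ε := by rw [hL']; exact Real.exp_pos _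
  have hn' : (0 : ℝ) < n := by exact_mod_cast hn
  set l := (1 + η) ^ 2 * L / μ with hl
  set m := μ / (1 + η) with hm
  have hm0 : 0 < m := by positivity
  have hmμ : m ≤ μ := div_le_self hμ.le (by linarith)
  refine ⟨?_, ?_⟩
  · unfold Rn
    refine iInf₂_le_of_le (σ * l) (by positivity) (iSup₂_le fun θ hθ => ?_)
    refine (sup_upper hσ (by linarith) hm0.le hθ).trans (ENNReal.ofReal_le_ofReal ?_)
    have hk : (k : ℝ) = n * ε := by rw [hε]; field_simp
    rw [hk, ← hμe]
    calc _ = (n : ℝ) * σ ^ 2 * (ε * μ ^ 2 - (ε * (μ ^ 2 - m ^ 2) * Qf (l - m) - rho l 0)) := by ring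
      _ ≤ _ := by gcongr
  · refine key.trans ?_
    have a1 := rho_nonneg l 0
    have a2 := Qf_nonneg (l - m)
    have a3 := Qf_le_one (l - m)
    have a4 : 0 ≤ μ ^ 2 - m ^ 2 := by nlinarith
    have : ε * (μ ^ 2 - m ^ 2) * Qf (l - m) ≤ ε * (μ ^ 2 - m ^ 2) := 
      mul_le_of_le_one_right (by positivity) a3
    nlinarith [mul_nonneg hε0.le (sq_nonneg m)]

lemma Rn_lower {n k : ℕ} {τ σ ε μ L δ : ℝ} (hn : 0 < n) (hk : k ≤ n) (hσ : 0 < σ) (hτ : 0 < τ)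
    (hε : ε = (k : ℝ) / n) (hμe : μ = τ / σ) (hL' : ε = Real.exp (-L))
    (hδ : 0 < δ) (hμ : 0 < μ) (hμ1 : μ ≤ 1) (hL : 0 < L)
    (h1 : μ ^ 2 ≤ δ * L) (h2 : 1 ≤ (1 - 2 * δ) * L / μ) (h3 : 2 * Real.exp (-L) ≤ phi 4)
    (h4 : 4 * (L ^ 2 * Real.exp (-(δ * L))) ≤ Real.exp (-3)) :
    ENNReal.ofReal ((n : ℝ) * σ ^ 2 * (ε * μ ^ 2 -
      Real.exp (-(1 / 2) * ((1 - 2 * δ) * L / μ) ^ 2))) ≤ Rn n k τ σ := by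
  have hn' : (0 : ℝ) < n := by exact_mod_cast hn
  unfold Rn
  refine le_iInf₂ fun lam hlam => ?_
  have hl : 0 ≤ lam / σ := by positivity
  obtain ⟨θ, hθ, hR⟩ := sup_lower (n := n) (k := k) (l := lam / σ) hσ hl hτ hk
  rw [mul_div_cancel₀ _ hσ.ne'] at hR
  refine le_trans ?_ (le_iSup₂_of_le θ hθ hR)
  apply ENNReal.ofReal_le_ofReal
  have key := D_low hδ hμ hμ1 hL h1 h2 h3 h4 hl
  rw [← hL'] at key
  have hk : (k : ℝ) = n * ε := by rw [hε]; field_simp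
  rw [hk, ← hμe]
  calc _ ≤ (n : ℝ) * σ ^ 2 * (ε * μ ^ 2 - (2 * ε * μ ^ 2 * Qf (lam / σ - μ) - rho (lam / σ) 0)) := by gcongr
    _ = _ := by ring

/-- Proposition `lem::lasso-risk-regime-1`. -/
theorem statement1
    (k : ℕ → ℕ) (τ σ ε μ : ℕ → ℝ)
    (hk : ∀ n, 1 ≤ n → 1 ≤ k n ∧ k n ≤ n)
    (hτ : ∀ n, 0 < τ n) (hσ : ∀ n, 0 < σ n)
    (hε : ∀ n, ε n = (k n : ℝ) / n) (hμ : ∀ n, μ n = τ n / σ n)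
    (hε0 : Tendsto ε atTop (𝓝 0)) (hμ0 : Tendsto μ atTop (𝓝 0)) :
    ∃ c : ℕ → ℝ, Tendsto c atTop (𝓝 1) ∧
      ∀ᶠ n in atTop,
        (⨅ (lam : ℝ) (_ : 0 ≤ lam),
            ⨆ θ ∈ paramSet n (k n) (τ n), risk n (σ n) (softEst n lam) θ) =
          ENNReal.ofReal ((n : ℝ) * σ n ^ 2 *
            (ε n * μ n ^ 2 -
              Real.exp (-(1 / 2) * (1 / μ n ^ 2) * Real.log (1 / ε n) ^ 2 * c n))) := by
  set L : ℕ → ℝ := fun n => Real.log (1 / ε n) with hLdef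
  have hn0 : ∀ᶠ n : ℕ in atTop, 0 < n := eventually_gt_atTop 0
  have hεpos : ∀ᶠ n in atTop, 0 < ε n := by
    filter_upwards [hn0] with n hn
    rw [hε]
    have := (hk n hn).1
    have h1 : (0 : ℝ) < k n := by exact_mod_cast this
    have h2 : (0 : ℝ) < n := by exact_mod_cast hn
    positivity
  have hμpos : ∀ n, 0 < μ n := fun n => by rw [hμ]; exact div_pos (hτ n) (hσ n)
  have hLe : ∀ᶠ n in atTop, ε n = Real.exp (-L n) := by
    filter_upwards [hεpos] with n hn
    rw [hLdef]; simp [Real.exp_log hn]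
  have hLtop : Tendsto L atTop atTop := by
    have h1 : Tendsto ε atTop (𝓝[>] 0) := tendsto_nhdsWithin_iff.2 ⟨hε0, hεpos⟩
    have h2 := (tendsto_inv_nhdsGT_zero.comp h1)
    have h3 := Real.tendsto_log_atTop.comp h2
    refine h3.congr fun n => ?_
    simp [hLdef]
  have hμinv : Tendsto (fun n => (μ n)⁻¹) atTop atTop :=
    tendsto_inv_nhdsGT_zero.comp
      (tendsto_nhdsWithin_iff.2 ⟨hμ0, Eventually.of_forall hμpos⟩)
  have hLμ : Tendsto (fun n => L n / μ n) atTop atTop := by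
    simpa [div_eq_mul_inv] using hLtop.atTop_mul_atTop₀ hμinv
  have hLpos : ∀ᶠ n in atTop, 0 < L n := hLtop.eventually_gt_atTop 0
  have hμ1 : ∀ᶠ n in atTop, μ n ≤ 1 := (hμ0.eventually_lt_const one_pos).mono fun n h => h.le
  have hup : ∀ η > 0, ∀ᶠ n : ℕ in atTop, Rn n (k n) (τ n) (σ n) ≤ ENNReal.ofReal ((n : ℝ) * σ n ^ 2 *
      (ε n * μ n ^ 2 - Real.exp (-(1 / 2) * (1 + η) * ((1 + η) ^ 2 * L n / μ n) ^ 2))) ∧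
      Real.exp (-(1 / 2) * (1 + η) * ((1 + η) ^ 2 * L n / μ n) ^ 2) ≤ ε n * μ n ^ 2 := by
    intro η hη
    have hlam : Tendsto (fun n => (1 + η) ^ 2 * L n / μ n) atTop atTop := by
      have := hLμ.const_mul_atTop (show 0 < (1 + η) ^ 2 by positivity)
      simpa [mul_div_assoc] using this
    have c2 : ∀ᶠ n in atTop, 5 ≤ (1 - ((1 + η) ^ 2)⁻¹) * Real.exp (-2) * (1 + η) ^ 4 * L n ^ 2 *
        Real.exp (η * L n) := by
      have hpos : 0 < (1 - ((1 + η) ^ 2)⁻¹) * Real.exp (-2) * (1 + η) ^ 4 := by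
        have : ((1 + η) ^ 2)⁻¹ < 1 := inv_lt_one_of_one_lt₀ (by nlinarith)
        have : 0 < 1 - ((1 + η) ^ 2)⁻¹ := by linarith
        positivity
      have t1 : Tendsto (fun n => (1 - ((1 + η) ^ 2)⁻¹) * Real.exp (-2) * (1 + η) ^ 4 * L n ^ 2)
          atTop atTop := ((tendsto_pow_atTop two_ne_zero).comp hLtop).const_mul_atTop hpos
      have t2 : Tendsto (fun n => Real.exp (η * L n)) atTop atTop :=
        Real.tendsto_exp_atTop.comp (hLtop.const_mul_atTop hη)
      exact (t1.atTop_mul_atTop₀ t2).eventually_ge_atTop 5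
    have c3 : ∀ᶠ x : ℝ in atTop, x ^ 3 ≤ (√(2 * Real.pi))⁻¹ * Real.exp (η / 2 * x ^ 2) := by
      have h := (isLittleO_pow_exp_pos_mul_atTop 3 (half_pos hη)).bound
        (show 0 < (√(2 * Real.pi))⁻¹ by positivity)
      filter_upwards [h, eventually_ge_atTop 1] with x hx hx1
      rw [Real.norm_of_nonneg (by positivity), Real.norm_of_nonneg (by positivity)] at hx
      refine hx.trans ?_
      gcongr
      nlinarith
    filter_upwards [hn0, hLe, hLpos, hμ1, hlam.eventually_ge_atTop 1, c2, hlam.eventually c3]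
      with n a1 a2 a3 a4 a5 a6 a7
    exact Rn_upper a1 (hσ n) (hε n) (hμ n) a2 hη (hμpos n) a4 a3 a5 a6 a7
  have hlow : ∀ δ, 0 < δ → δ < 1 / 2 → ∀ᶠ n : ℕ in atTop, ENNReal.ofReal ((n : ℝ) * σ n ^ 2 *
      (ε n * μ n ^ 2 - Real.exp (-(1 / 2) * ((1 - 2 * δ) * L n / μ n) ^ 2))) ≤
      Rn n (k n) (τ n) (σ n) := by
    intro δ hδ hδ2
    have hlam : Tendsto (fun n => (1 - 2 * δ) * L n / μ n) atTop atTop := by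
      have := hLμ.const_mul_atTop (show 0 < 1 - 2 * δ by linarith)
      simpa [mul_div_assoc] using this
    have c1 : ∀ᶠ n in atTop, 1 ≤ δ * L n := (hLtop.const_mul_atTop hδ).eventually_ge_atTop 1
    have c3 : ∀ᶠ n in atTop, 2 * Real.exp (-L n) ≤ phi 4 := by
      have t := (Real.tendsto_exp_neg_atTop_nhds_zero.comp hLtop).const_mul 2
      rw [mul_zero] at t
      exact (t.eventually_lt_const (phi_pos 4)).mono fun n h => h.le
    have c4 : ∀ᶠ x : ℝ in atTop, 4 * (x ^ 2 * Real.exp (-(δ * x))) ≤ Real.exp (-3) := by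
      have h := (isLittleO_pow_exp_pos_mul_atTop 2 hδ).bound
        (show 0 < Real.exp (-3) / 4 by positivity)
      filter_upwards [h] with x hx
      rw [Real.norm_of_nonneg (by positivity), Real.norm_of_nonneg (by positivity)] at hx
      rw [Real.exp_neg (δ * x), ← div_eq_mul_inv, ← mul_div_assoc, div_le_iff₀ (Real.exp_pos _)]
      linarith
    filter_upwards [hn0, hLe, hLpos, hμ1, hlam.eventually_ge_atTop 1, c1, c3, hLtop.eventually c4]
      with n a1 a2 a3 a4 a5 a6 a7 a8
    have := hμpos n
    exact Rn_lower a1 (hk n a1).2 (hσ n) (hτ n) (hε n) (hμ n) a2 hδ this a4 a3 (by nlinarith) a5 a7 a8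
  set D : ℕ → ℝ := fun n => ε n * μ n ^ 2 - (Rn n (k n) (τ n) (σ n)).toReal / (n * σ n ^ 2) with hD
  have hN : ∀ n : ℕ, 0 < n → 0 < (n : ℝ) * σ n ^ 2 := fun n hn => by
    have h2 : (0 : ℝ) < n := by exact_mod_cast hn
    have := hσ n
    positivity
  have hDup : ∀ η > 0, ∀ᶠ n : ℕ in atTop,
      Real.exp (-(1 / 2) * (1 + η) * ((1 + η) ^ 2 * L n / μ n) ^ 2) ≤ D n := by
    intro η hη
    filter_upwards [hup η hη, hn0] with n hn h0
    have h := ENNReal.toReal_mono ENNReal.ofReal_ne_top hn.1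
    have hp := hN n h0
    rw [ENNReal.toReal_ofReal (mul_nonneg hp.le (by linarith [hn.2]))] at h
    have := (div_le_iff₀' hp).2 h
    simp only [hD]; linarith
  have hfin : ∀ᶠ n in atTop, Rn n (k n) (τ n) (σ n) ≠ ⊤ := by
    filter_upwards [hup 1 one_pos] with n hn
    exact ne_top_of_le_ne_top ENNReal.ofReal_ne_top hn.1
  have hDlow : ∀ δ, 0 < δ → δ < 1 / 2 → ∀ᶠ n : ℕ in atTop,
      D n ≤ Real.exp (-(1 / 2) * ((1 - 2 * δ) * L n / μ n) ^ 2) := by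
    intro δ hδ hδ2
    filter_upwards [hlow δ hδ hδ2, hn0, hfin] with n hn h0 hf
    have hp := hN n h0
    have h := (ENNReal.ofReal_le_iff_le_toReal hf).1 hn
    have := (le_div_iff₀' hp).2 h
    simp only [hD]; linarith
  have hDpos : ∀ᶠ n in atTop, 0 < D n := by
    filter_upwards [hDup 1 one_pos] with n hn
    exact (Real.exp_pos _).trans_le hn
  refine ⟨fun n => Real.log (D n) * (-2 * μ n ^ 2 / L n ^ 2), ?_, ?_⟩
  · rw [tendsto_order]
    constructor
    · intro a ha
      have hcont : Tendsto (fun δ : ℝ => (1 - 2 * δ) ^ 2) (𝓝[>] 0) (𝓝 1) := by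
        have : Continuous (fun δ : ℝ => (1 - 2 * δ) ^ 2) := by fun_prop
        simpa using (this.tendsto 0).mono_left nhdsWithin_le_nhds
      have hlt : ∀ᶠ δ : ℝ in 𝓝[>] 0, δ < 1 / 2 :=
        (eventually_lt_nhds (by norm_num : (0:ℝ) < 1 / 2)).filter_mono nhdsWithin_le_nhds
      obtain ⟨δ, h1, h2, h3⟩ := ((hcont.eventually_const_lt ha).and
        (hlt.and self_mem_nhdsWithin)).exists
      filter_upwards [hDlow δ h3 h2, hDpos, hLpos] with n b1 b2 b3
      refine h1.trans_le ?_
      have b4 := Real.log_le_log b2 b1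
      rw [Real.log_exp] at b4
      have hm := hμpos n
      have b5 : (0:ℝ) ≤ 2 * μ n ^ 2 / L n ^ 2 := by positivity
      have b6 := mul_le_mul_of_nonneg_right b4 b5
      have e : -(1 / 2) * ((1 - 2 * δ) * L n / μ n) ^ 2 * (2 * μ n ^ 2 / L n ^ 2) = -(1 - 2 * δ) ^ 2 := by
        field_simp
      rw [e] at b6
      have e2 : Real.log (D n) * (-2 * μ n ^ 2 / L n ^ 2) =
        - (Real.log (D n) * (2 * μ n ^ 2 / L n ^ 2)) := by ring
      rw [e2]; linarith
    · intro a ha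
      have hcont : Tendsto (fun η : ℝ => (1 + η) ^ 5) (𝓝[>] 0) (𝓝 1) := by
        have : Continuous (fun η : ℝ => (1 + η) ^ 5) := by fun_prop
        simpa using (this.tendsto 0).mono_left nhdsWithin_le_nhds
      obtain ⟨η, h1, h3⟩ := ((hcont.eventually_lt_const ha).and self_mem_nhdsWithin).exists
      filter_upwards [hDup η h3, hDpos, hLpos] with n b1 b2 b3
      refine lt_of_le_of_lt ?_ h1
      have b4 := Real.log_le_log (Real.exp_pos _) b1
      rw [Real.log_exp] at b4
      have hm := hμpos n
      have b5 : (0:ℝ) ≤ 2 * μ n ^ 2 / L n ^ 2 := by positivity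
      have b6 := mul_le_mul_of_nonneg_right b4 b5
      have e : -(1 / 2) * (1 + η) * ((1 + η) ^ 2 * L n / μ n) ^ 2 * (2 * μ n ^ 2 / L n ^ 2) =
          -(1 + η) ^ 5 := by
        field_simp
      rw [e] at b6
      have e2 : Real.log (D n) * (-2 * μ n ^ 2 / L n ^ 2) =
        - (Real.log (D n) * (2 * μ n ^ 2 / L n ^ 2)) := by ring
      rw [e2]; linarith
  · filter_upwards [hDpos, hLpos, hfin, hn0] with n b1 b2 b3 b4
    change Rn n (k n) (τ n) (σ n) = _
    have hm := hμpos n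
    have hp := hN n b4
    have e : -(1 / 2) * (1 / μ n ^ 2) * Real.log (1 / ε n) ^ 2 *
        (Real.log (D n) * (-2 * μ n ^ 2 / L n ^ 2)) = Real.log (D n) := by
      change -(1 / 2) * (1 / μ n ^ 2) * L n ^ 2 * _ = _
      field_simp
    rw [e, Real.exp_log b1]
    simp only [hD]
    rw [sub_sub_cancel, mul_div_cancel₀ _ hp.ne', ENNReal.ofReal_toReal b3]
end
end

section
/- Consider the Gaussian sequence model with noise level σₙ and the SNR-aware parameter space Θ(kₙ, τₙ). Suppose εₙ = kₙ/n → 0 and μₙ = τₙ/σₙ → 0 as n → ∞. Then for all sufficiently large n, the optimally tuned hard thresholding estimator has supremum risk exactly: inf over λ > 0 of sup over θ ∈ Θ(kₙ,τₙ) of E_θ‖η̂_H(y,λ) − θ‖₂² = n σₙ² εₙ μₙ². -/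
open MeasureTheory ProbabilityTheory Filter
open scoped ENNReal NNReal Topology

noncomputable section

/-- Hard thresholding estimator `[η̂_H(y,λ)]ᵢ = yᵢ·1{|yᵢ| > λ}`. -/
def hardEst (n : ℕ) (lam : ℝ) : (Fin n → ℝ) → Fin n → ℝ :=
  fun y i => if lam < |y i| then y i else 0

def r1 (lam t : ℝ) (v : ℝ≥0) : ℝ≥0∞ :=
  ∫⁻ y, ENNReal.ofReal (((if lam < |y| then y else 0) - t) ^ 2) ∂(gaussianReal t v)

lemma meas_hard (lam t : ℝ) :
    Measurable fun y : ℝ => ENNReal.ofReal (((if lam < |y| then y else 0) - t) ^ 2) := by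
  have : Measurable fun y : ℝ => if lam < |y| then y else 0 :=
    Measurable.ite (measurableSet_lt measurable_const (by fun_prop)) measurable_id measurable_const
  fun_prop

lemma risk_eq_s2 (n : ℕ) (σ lam : ℝ) (θ : Fin n → ℝ) :
    risk n σ (hardEst n lam) θ = ∑ i, r1 lam (θ i) ((σ ^ 2).toNNReal) := by
  unfold risk hardEst r1
  simp_rw [ENNReal.ofReal_sum_of_nonneg (fun i _ => sq_nonneg _)]
  rw [lintegral_finsetSum]
  · refine Finset.sum_congr rfl fun i _ => ?_
    have h := (measurePreserving_eval
      (fun i => gaussianReal (θ i) ((σ ^ 2).toNNReal)) i).lintegral_comp (meas_hard lam (θ i))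
    exact h
  · intro i _
    exact (meas_hard lam (θ i)).comp (measurable_pi_apply i)

lemma r1_ge (lam t : ℝ) (v : ℝ≥0) (h : 2 * |t| ≤ lam) : ENNReal.ofReal (t ^ 2) ≤ r1 lam t v := by
  have : ENNReal.ofReal (t ^ 2) = ∫⁻ _, ENNReal.ofReal (t ^ 2) ∂(gaussianReal t v) := by simp
  rw [this]
  refine lintegral_mono fun y => ENNReal.ofReal_le_ofReal ?_
  split_ifs with hy
  · rw [sq_le_sq]
    have := abs_sub_abs_le_abs_sub y t
    linarith
  · simp

lemma p_pos : 0 < gaussianReal 0 1 {z : ℝ | 1 < |z|} := by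
  rw [pos_iff_ne_zero]
  intro h
  have h2 := gaussianReal_absolutelyContinuous' 0 (one_ne_zero) h
  have : volume (Set.Ioo (1:ℝ) 2) ≤ volume {z : ℝ | 1 < |z|} :=
    measure_mono fun z hz => lt_of_lt_of_le hz.1 (le_abs_self z)
  rw [h2, Real.volume_Ioo] at this
  norm_num at this

lemma r1_zero_ge (lam σ : ℝ) (hσ : 0 < σ) (h : lam ≤ σ) :
    ENNReal.ofReal (σ ^ 2) * gaussianReal 0 1 {z : ℝ | 1 < |z|} ≤ r1 lam 0 ((σ ^ 2).toNNReal) := by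
  have hm : gaussianReal 0 ((σ ^ 2).toNNReal) = (gaussianReal 0 1).map (σ * ·) := by
    rw [gaussianReal_map_const_mul]
    congr 1
    · simp
    · ext; simp [sq_nonneg]
  have hs : MeasurableSet {z : ℝ | 1 < |z|} := measurableSet_lt measurable_const (by fun_prop)
  unfold r1
  rw [hm, lintegral_map (meas_hard lam 0) (by fun_prop), ← lintegral_indicator_const hs]
  refine lintegral_mono fun z => ?_
  by_cases hz : 1 < |z|
  · have h1 : σ < |σ * z| := by
      rw [abs_mul, abs_of_pos hσ]; nlinarith
    rw [Set.indicator_of_mem (by exact hz), if_pos (lt_of_le_of_lt h h1)]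
    apply ENNReal.ofReal_le_ofReal
    rw [sub_zero, sq_le_sq, abs_of_pos hσ]
    exact h1.le
  · rw [Set.indicator_of_notMem (by exact hz)]; exact zero_le

def tailI (v : ℝ≥0) (s : ℝ) : ℝ≥0∞ :=
  ∫⁻ z, ENNReal.ofReal (if s < |z| then z ^ 2 else 0) ∂(gaussianReal 0 v)

lemma r1_le (lam t M : ℝ) (v : ℝ≥0) (h : |t| ≤ M) :
    r1 lam t v ≤ ENNReal.ofReal (t ^ 2) + tailI v (lam - M) := by
  have hm : gaussianReal t v = (gaussianReal 0 v).map (· + t) := by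
    rw [gaussianReal_map_add_const, zero_add]
  have hc : ENNReal.ofReal (t ^ 2) = ∫⁻ _, ENNReal.ofReal (t ^ 2) ∂(gaussianReal 0 v) := by simp
  unfold r1 tailI
  rw [hm, lintegral_map (meas_hard lam t) (by fun_prop), hc,
    ← lintegral_add_left measurable_const]
  refine lintegral_mono fun z => ?_
  rw [← ENNReal.ofReal_add (sq_nonneg _) (by split_ifs <;> positivity)]
  apply ENNReal.ofReal_le_ofReal
  by_cases hz : lam < |z + t|
  · have := abs_add_le z t
    rw [if_pos hz, if_pos (by linarith)]
    nlinarith [sq_nonneg t]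
  · rw [if_neg hz]
    have : 0 ≤ if lam - M < |z| then z ^ 2 else 0 := by split_ifs <;> positivity
    nlinarith

lemma tailI_tendsto (v : ℝ≥0) : Tendsto (tailI v) atTop (𝓝 0) := by
  have h0 : (0 : ℝ≥0∞) = ∫⁻ _, (0:ℝ≥0∞) ∂(gaussianReal 0 v) := by simp
  unfold tailI
  rw [h0]
  refine tendsto_lintegral_filter_of_dominated_convergence
    (fun z => ENNReal.ofReal (z ^ 2)) ?_ ?_ ?_ ?_
  · refine Eventually.of_forall fun s => ?_
    have : Measurable fun z : ℝ => if s < |z| then z ^ 2 else 0 :=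
      Measurable.ite (measurableSet_lt measurable_const (by fun_prop)) (by fun_prop)
        measurable_const
    fun_prop
  · refine Eventually.of_forall fun s => Eventually.of_forall fun z => ?_
    apply ENNReal.ofReal_le_ofReal
    split_ifs
    · exact le_rfl
    · positivity
  · have h2 : MemLp id 2 (gaussianReal 0 v) := memLp_id_gaussianReal 2
    exact h2.integrable_sq.lintegral_lt_top.ne
  · refine Eventually.of_forall fun z => ?_
    refine tendsto_const_nhds.congr' ?_
    filter_upwards [eventually_ge_atTop |z|] with s hs
    rw [if_neg (not_lt.2 hs), ENNReal.ofReal_zero]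

lemma upper (n k : ℕ) (τ σ : ℝ) :
    (⨅ (lam : ℝ) (_ : 0 < lam), ⨆ θ ∈ paramSet n k τ, risk n σ (hardEst n lam) θ)
      ≤ ENNReal.ofReal (k * τ ^ 2) := by
  set M := √(k * τ ^ 2) with hM
  set v := (σ ^ 2).toNNReal
  have ht : Tendsto (fun s => ENNReal.ofReal (k * τ ^ 2) + n * tailI v s) atTop
      (𝓝 (ENNReal.ofReal (k * τ ^ 2) + n * 0)) :=
    tendsto_const_nhds.add (ENNReal.Tendsto.const_mul (tailI_tendsto v) (by simp))
  rw [mul_zero, add_zero] at ht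
  refine ge_of_tendsto ht ?_
  filter_upwards [eventually_gt_atTop 0] with s hs
  have hl : 0 < s + M := by positivity
  refine (iInf₂_le (s + M) hl).trans (iSup₂_le fun θ hθ => ?_)
  rw [risk_eq_s2]
  calc _ ≤ ∑ i, (ENNReal.ofReal (θ i ^ 2) + tailI v s) := by
        refine Finset.sum_le_sum fun i _ => ?_
        have := r1_le (s + M) (θ i) M v ?_
        · simpa using this
        · apply Real.abs_le_sqrt
          exact (Finset.single_le_sum (f := fun i => θ i ^ 2) (fun i _ => sq_nonneg _)
            (Finset.mem_univ i)).trans hθ.2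
    _ = ENNReal.ofReal (∑ i, θ i ^ 2) + n * tailI v s := by
        rw [Finset.sum_add_distrib, ENNReal.ofReal_sum_of_nonneg (fun i _ => sq_nonneg _)]
        simp
    _ ≤ _ := by gcongr; exact hθ.2

lemma lower (n k : ℕ) (τ σ lam : ℝ) (hkn : k ≤ n) (hτ : 0 < τ) (hσ : 0 < σ)
    (h1 : 2 * τ ≤ σ)
    (h2 : ENNReal.ofReal ((τ / σ) ^ 2) ≤ gaussianReal 0 1 {z : ℝ | 1 < |z|}) :
    ENNReal.ofReal (k * τ ^ 2) ≤ ⨆ θ ∈ paramSet n k τ, risk n σ (hardEst n lam) θ := by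
  by_cases hl : 2 * τ ≤ lam
  · obtain ⟨s, -, hs⟩ := Finset.exists_subset_card_eq (s := (Finset.univ : Finset (Fin n)))
      (n := k) (by simpa using hkn)
    have hsum : ∑ i, (if i ∈ s then τ else 0) ^ 2 = k * τ ^ 2 := by
      simp [ite_pow, hs]
    have hmem : (fun i => if i ∈ s then τ else 0) ∈ paramSet n k τ := by
      refine ⟨?_, hsum.le⟩
      have : {i | (if i ∈ s then τ else 0) ≠ 0} = (s : Set (Fin n)) := by
        ext i; simp [hτ.ne']
      rw [this, Set.ncard_coe_finset, hs]
    refine le_trans ?_ (le_iSup₂ (f := fun θ (_ : θ ∈ paramSet n k τ) =>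
      risk n σ (hardEst n lam) θ) _ hmem)
    rw [risk_eq_s2, ← hsum, ENNReal.ofReal_sum_of_nonneg (fun i _ => sq_nonneg _)]
    refine Finset.sum_le_sum fun i _ => r1_ge _ _ _ ?_
    split_ifs
    · rwa [abs_of_pos hτ]
    · simp; linarith
  · have hmem : (fun _ => 0) ∈ paramSet n k τ := by
      refine ⟨by simp, ?_⟩
      simp; positivity
    refine le_trans ?_ (le_iSup₂ (f := fun θ (_ : θ ∈ paramSet n k τ) =>
      risk n σ (hardEst n lam) θ) _ hmem)
    rw [risk_eq_s2]
    simp only [Finset.sum_const, Finset.card_univ, Fintype.card_fin, nsmul_eq_mul]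
    calc ENNReal.ofReal (k * τ ^ 2)
        = k * (ENNReal.ofReal (σ ^ 2) * ENNReal.ofReal ((τ / σ) ^ 2)) := by
          rw [← ENNReal.ofReal_mul (sq_nonneg _), ENNReal.ofReal_mul (by positivity)]
          congr 1
          · simp
          · congr 1; field_simp
      _ ≤ n * (ENNReal.ofReal (σ ^ 2) * gaussianReal 0 1 {z : ℝ | 1 < |z|}) := by gcongr
      _ ≤ _ := by
          gcongr
          exact r1_zero_ge lam σ hσ (by linarith)

/-- Proposition `lem::hardthreshold-risk-regime-1`. -/
theorem statement2
    (k : ℕ → ℕ) (τ σ ε μ : ℕ → ℝ)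
    (hk : ∀ n, 1 ≤ n → 1 ≤ k n ∧ k n ≤ n)
    (hτ : ∀ n, 0 < τ n) (hσ : ∀ n, 0 < σ n)
    (hε : ∀ n, ε n = (k n : ℝ) / n) (hμ : ∀ n, μ n = τ n / σ n)
    (hε0 : Tendsto ε atTop (𝓝 0)) (hμ0 : Tendsto μ atTop (𝓝 0)) :
    ∀ᶠ n in atTop,
      (⨅ (lam : ℝ) (_ : 0 < lam),
          ⨆ θ ∈ paramSet n (k n) (τ n), risk n (σ n) (hardEst n lam) θ) =
        ENNReal.ofReal ((n : ℝ) * σ n ^ 2 * ε n * μ n ^ 2) := by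
  have hp : ∀ᶠ n in atTop,
      ENNReal.ofReal (μ n ^ 2) < gaussianReal 0 1 {z : ℝ | 1 < |z|} := by
    have : Tendsto (fun n => ENNReal.ofReal (μ n ^ 2)) atTop (𝓝 (ENNReal.ofReal (0 ^ 2))) :=
      (ENNReal.continuous_ofReal.tendsto _).comp (hμ0.pow 2)
    refine this.eventually_lt_const ?_
    simpa using p_pos
  have hh : ∀ᶠ n in atTop, μ n < 1 / 2 := hμ0.eventually_lt_const (by norm_num)
  filter_upwards [hp, hh, eventually_ge_atTop 1] with n h1 h2 hn
  have hs := hσ n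
  have hn' : (n : ℝ) ≠ 0 := by positivity
  have he : (n : ℝ) * σ n ^ 2 * ε n * μ n ^ 2 = k n * τ n ^ 2 := by
    rw [hε, hμ]; field_simp
  rw [he]
  refine le_antisymm (upper _ _ _ _) (le_iInf₂ fun lam _ => ?_)
  rw [hμ] at h1 h2
  rw [div_lt_iff₀ hs] at h2
  exact lower n (k n) (τ n) (σ n) lam (hk n hn).2 (hτ n) hs (by linarith) h1.le
end
end
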